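/- arXiv:2106.14834 — 7 statements merged into one kernel-verified Lean document; each statement's English description precedes it below -/
import Mathlib

section
/- Let p ≥ 1 be an integer and let α be a real number with 0 ≤ α < p. Then for every θ ∈ ℝ with θ ≠ 0, the Fourier transform of the left Riemann–Liouville fractional derivative of the cardinal B-spline φ_p satisfies ∫_ℝ (D₋^α φ_p)(x) e^{-iθx} dx = (iθ)^α · ((1 - e^{-iθ})/(iθ))^{p+1}, where (iθ)^α denotes the principal complex power |θ|^α e^{i(π/2)sign(θ)α}. -/
open MeasureTheory

/-- Cardinal B-spline. -/
noncomputable def cardinalBSpline : ℕ → ℝ → ℝ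
  | 0 => fun t => if 0 ≤ t ∧ t < 1 then 1 else 0
  | (p + 1) => fun t =>
      (t / ((p : ℝ) + 1)) * cardinalBSpline p t
        + (((p : ℝ) + 2 - t) / ((p : ℝ) + 1)) * cardinalBSpline p (t - 1)

/-- Left Riemann–Liouville fractional derivative on the real line, with
`m = ⌊α⌋ + 1` the integer such that `m - 1 ≤ α < m`. -/
noncomputable def fracDerivLeft (α : ℝ) (u : ℝ → ℝ) (x : ℝ) : ℝ :=
  (1 / Real.Gamma ((⌊α⌋₊ : ℝ) + 1 - α)) *
    iteratedDeriv (⌊α⌋₊ + 1)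
      (fun z => ∫ y in Set.Iic z, (z - y) ^ ((⌊α⌋₊ : ℝ) + 1 - α - 1) * u y) x

/-- Principal complex power `(iθ)^α = |θ|^α e^{i (π/2) sign(θ) α}`. -/
noncomputable def iThetaPow (θ α : ℝ) : ℂ :=
  ((|θ| ^ α : ℝ) : ℂ) * Complex.exp (Complex.I * (Real.pi / 2) * Real.sign θ * α)


open Filter Topology Set

noncomputable def nab : ℕ → (ℝ → ℝ) → ℝ → ℝ
  | 0, f => f
  | (n + 1), f => fun x => nab n f x - nab n f (x - 1)

noncomputable def gsp (γ x : ℝ) : ℝ := if 0 ≤ x then x ^ γ / Real.Gamma (γ + 1) else 0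

lemma nab_succ (n : ℕ) (f : ℝ → ℝ) (x : ℝ) : nab (n + 1) f x = nab n f x - nab n f (x - 1) := rfl

lemma nab_const_mul (n : ℕ) (c : ℝ) (f : ℝ → ℝ) (x : ℝ) :
    nab n (fun t => c * f t) x = c * nab n f x := by
  induction n generalizing x with
  | zero => rfl
  | succ n ih => simp only [nab, ih]; ring

lemma nab_leib (n : ℕ) (f : ℝ → ℝ) (x : ℝ) :
    nab (n + 1) (fun t => t * f t) x = x * nab (n + 1) f x + (n + 1) * nab n f (x - 1) := by
  induction n generalizing x with
  | zero => simp only [nab]; push_cast; ring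
  | succ n ih =>
    rw [nab_succ, ih, ih]
    simp only [nab]; push_cast; ring

lemma gsp_succ (p : ℕ) (x : ℝ) : gsp ((p + 1 : ℕ) : ℝ) x = (1 / ((p : ℝ) + 1)) * (x * gsp p x) := by
  unfold gsp
  split_ifs with h
  · have h1 : (p : ℝ) + 1 ≠ 0 := by positivity
    rw [Real.rpow_natCast, Real.rpow_natCast, Real.Gamma_nat_eq_factorial, Real.Gamma_nat_eq_factorial,
      Nat.factorial_succ]
    have : (p.factorial : ℝ) ≠ 0 := by positivity
    push_cast
    field_simp
    ring
  · simp

lemma bspline_eq (p : ℕ) : cardinalBSpline p = nab (p + 1) (gsp p) := by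
  induction p with
  | zero =>
    funext x
    simp only [cardinalBSpline, nab, gsp, Nat.cast_zero, Real.rpow_zero, zero_add, Real.Gamma_one]
    by_cases h0 : 0 ≤ x <;> by_cases h1 : x < 1
    · simp [h0, h1, not_le.2 h1]
    · simp [h0, h1, not_lt.1 h1]
    · simp [h0, not_le.2 h1]
    · exfalso; linarith
  | succ p ih =>
    funext x
    rw [show gsp ((p + 1 : ℕ) : ℝ) = fun x => (1 / ((p : ℝ) + 1)) * (x * gsp p x) from
      funext (gsp_succ p), nab_const_mul, nab_leib]
    simp only [cardinalBSpline]
    rw [ih, nab_succ (p + 1)]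
    have h1 : (p : ℝ) + 1 ≠ 0 := by positivity
    push_cast
    field_simp
    ring

/-- derivative on positives, all real γ -/
lemma gamma_rel (γ : ℝ) : γ / Real.Gamma (γ + 1) = 1 / Real.Gamma γ := by
  by_cases h : γ = 0
  · simp [h]
  · rw [Real.Gamma_add_one h]
    by_cases h2 : Real.Gamma γ = 0
    · simp [h2]
    · field_simp

lemma gsp_deriv_pos (γ x : ℝ) (hx : 0 < x) : HasDerivAt (gsp γ) (gsp (γ - 1) x) x := by
  have h := (Real.hasDerivAt_rpow_const (x := x) (p := γ) (Or.inl hx.ne')).div_const (Real.Gamma (γ + 1))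
  have e : gsp (γ - 1) x = γ * x ^ (γ - 1) / Real.Gamma (γ + 1) := by
    unfold gsp
    rw [if_pos hx.le, sub_add_cancel, mul_comm, mul_div_assoc, gamma_rel]; ring
  rw [e]
  refine h.congr_of_eventuallyEq ?_
  filter_upwards [lt_mem_nhds hx] with y hy
  simp [gsp, hy.le]

lemma gsp_neg (γ x : ℝ) (hx : x < 0) : gsp γ x = 0 := by simp [gsp, hx]

lemma gsp_eq_max (γ : ℝ) (hγ : 0 < γ) (x : ℝ) : gsp γ x = (max x 0) ^ γ / Real.Gamma (γ + 1) := by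
  unfold gsp
  split_ifs with h
  · rw [max_eq_left h]
  · rw [max_eq_right (not_le.1 h).le, Real.zero_rpow hγ.ne', zero_div]

lemma gsp_cont (γ : ℝ) (hγ : 0 < γ) : Continuous (gsp γ) := by
  rw [funext (gsp_eq_max γ hγ)]
  exact ((continuous_id.max continuous_const).rpow_const (fun x => Or.inr hγ.le)).div_const _

lemma gsp_deriv (γ x : ℝ) (hγ : 1 < γ) : HasDerivAt (gsp γ) (gsp (γ - 1) x) x := by
  rcases lt_trichotomy x 0 with h | h | h
  · rw [gsp_neg _ _ h]
    refine (hasDerivAt_const x (0:ℝ)).congr_of_eventuallyEq ?_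
    filter_upwards [gt_mem_nhds h] with y hy
    exact gsp_neg _ _ hy
  · subst h
    refine hasDerivAt_of_hasDerivAt_of_ne' (f := gsp γ) (g := gsp (γ - 1)) (x := 0) ?_ ?_ ?_ 0
    · intro y hy
      rcases lt_or_gt_of_ne hy with h | h
      · rw [gsp_neg _ _ h]
        refine (hasDerivAt_const y (0:ℝ)).congr_of_eventuallyEq ?_
        filter_upwards [gt_mem_nhds h] with y hy
        exact gsp_neg _ _ hy
      · exact gsp_deriv_pos _ _ h
    · exact (gsp_cont γ (by linarith)).continuousAt
    · exact (gsp_cont (γ - 1) (by linarith)).continuousAt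
  · exact gsp_deriv_pos _ _ h

lemma nab_deriv (n : ℕ) (f f' : ℝ → ℝ) (h : ∀ x, HasDerivAt f (f' x) x) (x : ℝ) :
    HasDerivAt (nab n f) (nab n f' x) x := by
  induction n generalizing x with
  | zero => exact h x
  | succ n ih =>
    exact (ih x).sub ((ih (x - 1)).comp_sub_const x 1)

lemma nab_deriv_pos (n : ℕ) (γ x : ℝ) (hx : n < x) :
    HasDerivAt (nab n (gsp γ)) (nab n (gsp (γ - 1)) x) x := by
  induction n generalizing x with
  | zero => exact gsp_deriv_pos _ _ (by simpa using hx)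
  | succ n ih =>
    push_cast at hx
    exact (ih x (by linarith)).sub ((ih (x - 1) (by linarith)).comp_sub_const x 1)

lemma nab_bound (n : ℕ) (γ x : ℝ) (hγ : γ ≤ n) (hx : n < x) :
    |nab n (gsp γ) x| ≤ (x - n) ^ (γ - n) / |Real.Gamma (γ - n + 1)| := by
  induction n generalizing x γ with
  | zero =>
    have hx : 0 < x := by simpa using hx
    simp only [nab, gsp, if_pos hx.le, Nat.cast_zero, sub_zero]
    rw [abs_div, abs_of_nonneg (Real.rpow_nonneg hx.le _)]
  | succ n ih =>
    push_cast at hx hγ ⊢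
    have hd : ∀ y ∈ Icc (x - 1) x, HasDerivAt (nab n (gsp γ)) (nab n (gsp (γ - 1)) y) y :=
      fun y hy => nab_deriv_pos n γ y (by linarith [hy.1])
    obtain ⟨c, hc, e⟩ := exists_hasDerivAt_eq_slope (nab n (gsp γ)) (nab n (gsp (γ - 1)))
      (show x - 1 < x by linarith) (fun y hy => (hd y hy).continuousAt.continuousWithinAt)
      (fun y hy => hd y (Ioo_subset_Icc_self hy))
    have e2 : nab (n + 1) (gsp γ) x = nab n (gsp (γ - 1)) c := by
      rw [e, nab]; simp
    rw [e2]
    refine (ih (γ - 1) c (by linarith) (by linarith [hc.1])).trans ?_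
    rw [show γ - 1 - (n : ℝ) = γ - (n + 1) by ring]
    gcongr ?_ / _
    exact Real.rpow_le_rpow_of_nonpos (by linarith) (by linarith [hc.1]) (by linarith)

lemma iter_deriv (j n : ℕ) (γ : ℝ) (hγ : j < γ) :
    iteratedDeriv j (nab n (gsp γ)) = nab n (gsp (γ - j)) := by
  induction j generalizing γ with
  | zero => simp
  | succ j ih =>
    push_cast at hγ
    have hj : (0:ℝ) ≤ j := by positivity
    rw [iteratedDeriv_succ', funext fun x => (nab_deriv n _ _ (fun x => gsp_deriv γ x (by linarith)) x).deriv,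
      ih _ (by linarith)]
    congr 2
    push_cast; ring

lemma nab_cont (n : ℕ) (f : ℝ → ℝ) (h : Continuous f) : Continuous (nab n f) := by
  induction n with
  | zero => exact h
  | succ n ih => exact ih.sub (ih.comp (continuous_id.sub continuous_const))

lemma nab_neg (n : ℕ) (f : ℝ → ℝ) (h : ∀ x < 0, f x = 0) (x : ℝ) (hx : x < 0) : nab n f x = 0 := by
  induction n generalizing x with
  | zero => exact h x hx
  | succ n ih => simp [nab, ih x hx, ih (x - 1) (by linarith)]

/-- Shift-invariant integral functional. -/
lemma nab_conv (n : ℕ) (k f : ℝ → ℝ) (h : ∀ z, Integrable (fun y => k (z - y) * f y)) (z : ℝ) :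
    Integrable (fun y => k (z - y) * nab n f y) ∧
    ∫ y, k (z - y) * nab n f y = nab n (fun z => ∫ y, k (z - y) * f y) z := by
  induction n generalizing z with
  | zero => exact ⟨h z, rfl⟩
  | succ n ih =>
    have e : (fun y => k (z - y) * nab (n + 1) f y) = fun y => k (z - y) * nab n f y -
        (fun y => k (z - 1 - y) * nab n f y) (y - 1) := by
      funext y
      simp only [nab]
      rw [show z - 1 - (y - 1) = z - y by ring]; ring
    have i2 := (ih (z - 1)).1.comp_sub_right 1
    rw [e]
    refine ⟨(ih z).1.sub i2, ?_⟩
    rw [integral_sub (ih z).1 i2, integral_sub_right_eq_self (fun y => k (z - 1 - y) * nab n f y),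
      (ih z).2, (ih (z - 1)).2, nab]

lemma nab_exp (n : ℕ) (r : ℂ) (f : ℝ → ℝ) (h : Integrable (fun y : ℝ => (f y : ℂ) * Complex.exp (-(r * y)))) :
    Integrable (fun y : ℝ => (nab n f y : ℂ) * Complex.exp (-(r * y))) ∧
    ∫ y : ℝ, (nab n f y : ℂ) * Complex.exp (-(r * y)) =
      (1 - Complex.exp (-r)) ^ n * ∫ y : ℝ, (f y : ℂ) * Complex.exp (-(r * y)) := by
  induction n with
  | zero => exact ⟨h, by simp [nab]⟩
  | succ n ih =>
    have e : (fun y : ℝ => (nab (n + 1) f y : ℂ) * Complex.exp (-(r * y))) = fun y : ℝ =>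
        (nab n f y : ℂ) * Complex.exp (-(r * y)) - Complex.exp (-r) *
        (fun y : ℝ => (nab n f y : ℂ) * Complex.exp (-(r * y))) (y - 1) := by
      funext y
      simp only [nab]
      have : Complex.exp (-(r * y)) = Complex.exp (-r) * Complex.exp (-(r * ((y - 1 : ℝ) : ℂ))) := by
        rw [← Complex.exp_add]; congr 1; push_cast; ring
      rw [this]; push_cast; ring
    have i2 := (ih.1.comp_sub_right 1).const_mul (Complex.exp (-r))
    rw [e]
    refine ⟨ih.1.sub i2, ?_⟩
    rw [integral_sub ih.1 i2, integral_const_mul,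
      integral_sub_right_eq_self (fun y : ℝ => (nab n f y : ℂ) * Complex.exp (-(r * y))), ih.2]
    ring

noncomputable def rker (s t : ℝ) : ℝ := if 0 ≤ t then t ^ (s - 1) else 0

lemma ker_ind (s z : ℝ) (p : ℕ) : (fun y => rker s (z - y) * gsp p y) =
    indicator (Icc 0 z) (fun y => (z - y) ^ (s - 1) * (y ^ p / Real.Gamma (p + 1))) := by
  funext y
  by_cases h : y ∈ Icc 0 z
  · rw [indicator_of_mem h, rker, gsp, if_pos (by linarith [h.2]), if_pos h.1, Real.rpow_natCast]
  · rw [indicator_of_notMem h, rker, gsp]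
    by_cases h1 : 0 ≤ y
    · rw [if_neg (fun h2 => h ⟨h1, by linarith⟩), zero_mul]
    · rw [if_neg h1, mul_zero]

lemma ker_int (s : ℝ) (hs : 0 < s) (p : ℕ) (z : ℝ) : Integrable (fun y => rker s (z - y) * gsp p y) := by
  rw [ker_ind, integrable_indicator_iff measurableSet_Icc]
  rcases lt_or_ge z 0 with h | h
  · simp [Icc_eq_empty (not_le.2 h)]
  · rw [← intervalIntegrable_iff_integrableOn_Icc_of_le h]
    refine IntervalIntegrable.mul_continuousOn ?_ (by fun_prop)
    have := (intervalIntegral.intervalIntegrable_rpow' (a := 0) (b := z) (r := s - 1) (by linarith)).comp_sub_left z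
    simpa using this.symm

lemma ker_val (s : ℝ) (hs : 0 < s) (p : ℕ) (z : ℝ) :
    ∫ y, rker s (z - y) * gsp p y = Real.Gamma s * gsp (p + s) z := by
  rw [ker_ind, integral_indicator measurableSet_Icc]
  have hps : (0:ℝ) < p + s := by positivity
  rcases lt_trichotomy z 0 with h | h | h
  · simp [Icc_eq_empty (not_le.2 h), gsp_neg _ _ h]
  · subst h
    simp [gsp, Real.zero_rpow hps.ne']
  · rw [integral_Icc_eq_integral_Ioc, ← intervalIntegral.integral_of_le h.le, gsp, if_pos h.le]
    have hb := Complex.betaIntegral_scaled (p + 1) s h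
    have hg := Complex.Gamma_mul_Gamma_eq_betaIntegral (s := p + 1) (t := s)
      (by simp; positivity) (by simpa using hs)
    have e : ((∫ y in (0:ℝ)..z, (z - y) ^ (s - 1) * y ^ p : ℝ) : ℂ) =
        ∫ x in (0:ℝ)..z, (x : ℂ) ^ ((p:ℂ) + 1 - 1) * ((z : ℂ) - x) ^ ((s:ℂ) - 1) := by
      rw [← intervalIntegral.integral_ofReal]
      refine intervalIntegral.integral_congr fun x hx => ?_
      rw [uIcc_of_le h.le] at hx
      rw [add_sub_cancel_right, Complex.cpow_natCast]
      push_cast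
      rw [Complex.ofReal_cpow (by linarith [hx.2])]
      push_cast; ring
    have g1 : (Real.Gamma (p + 1 + s) : ℂ) = Complex.Gamma (p + 1 + s) := by
      rw [← Complex.Gamma_ofReal]; push_cast; rfl
    have g2 : (Real.Gamma (p + 1) : ℂ) = Complex.Gamma (p + 1) := by
      rw [← Complex.Gamma_ofReal]; push_cast; rfl
    have g3 : Real.Gamma (p + 1 + s) ≠ 0 := (Real.Gamma_pos_of_pos (by positivity)).ne'
    have g4 : Real.Gamma (p + 1) ≠ 0 := (Real.Gamma_pos_of_pos (by positivity)).ne'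
    have key : Real.Gamma (p + 1 + s) * (∫ y in (0:ℝ)..z, (z - y) ^ (s - 1) * y ^ p) =
        z ^ (p + s) * (Real.Gamma (p + 1) * Real.Gamma s) := by
      have : ((Real.Gamma (p + 1 + s) * (∫ y in (0:ℝ)..z, (z - y) ^ (s - 1) * y ^ p) : ℝ) : ℂ) =
        ((z ^ (p + s) * (Real.Gamma (p + 1) * Real.Gamma s) : ℝ) : ℂ) := by
        rw [Complex.ofReal_mul, e, hb]
        push_cast
        rw [g1, g2, ← Complex.Gamma_ofReal, hg, Complex.ofReal_cpow h.le]
        push_cast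
        rw [show (p:ℂ) + 1 + s - 1 = p + s by ring]
        ring
      exact_mod_cast this
    have : (∫ y in (0:ℝ)..z, (z - y) ^ (s - 1) * (y ^ p / Real.Gamma (p + 1))) =
      (∫ y in (0:ℝ)..z, (z - y) ^ (s - 1) * y ^ p) / Real.Gamma (p + 1) := by
      rw [← intervalIntegral.integral_div]
      congr 1; funext y; ring
    rw [this, show (p:ℝ) + s + 1 = p + 1 + s by ring]
    field_simp
    linarith

lemma frac_eq (p : ℕ) (α : ℝ) (hα0 : 0 ≤ α) (hαp : α < p) (x : ℝ) :
    fracDerivLeft α (cardinalBSpline p) x = nab (p + 1) (gsp (p - α)) x := by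
  unfold fracDerivLeft
  set s : ℝ := (⌊α⌋₊ : ℝ) + 1 - α with hs
  have hs0 : 0 < s := by have := Nat.lt_floor_add_one α; linarith
  have e : (fun z => ∫ y in Set.Iic z, (z - y) ^ (s - 1) * cardinalBSpline p y) =
      nab (p + 1) (fun z => Real.Gamma s * gsp (p + s) z) := by
    funext z
    rw [← funext (ker_val s hs0 p), ← (nab_conv (p + 1) (rker s) (gsp p) (ker_int s hs0 p) z).2,
      ← integral_indicator measurableSet_Iic, bspline_eq]
    congr 1; funext y
    by_cases h : y ≤ z
    · rw [indicator_of_mem (by exact h), rker, if_pos (by linarith)]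
    · rw [indicator_of_notMem (by exact h), rker, if_neg (by linarith), zero_mul]
  have e2 : nab (p + 1) (fun z => Real.Gamma s * gsp (p + s) z) =
      fun z => Real.Gamma s * nab (p + 1) (gsp (p + s)) z := funext (nab_const_mul _ _ _)
  rw [e, e2, iteratedDeriv_const_mul_field, iter_deriv _ _ _ (by push_cast; linarith)]
  have : (p:ℝ) + s - ((⌊α⌋₊ + 1 : ℕ) : ℝ) = p - α := by push_cast; rw [hs]; ring
  rw [this]
  have := (Real.Gamma_pos_of_pos hs0).ne'
  field_simp

lemma laplace_real (γ : ℝ) (hγ : 0 < γ) (r : ℝ) (hr : 0 < r) :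
    Integrable (fun y : ℝ => (gsp γ y : ℂ) * Complex.exp (-(r * y))) ∧
    ∫ y : ℝ, (gsp γ y : ℂ) * Complex.exp (-(r * y)) = (1 / (r : ℂ)) ^ ((γ : ℂ) + 1) := by
  have h := Complex.integral_cpow_mul_exp_neg_mul_Ioi (a := γ + 1) (r := r) (by simp; linarith) hr
  have hG : Real.Gamma (γ + 1) ≠ 0 := (Real.Gamma_pos_of_pos (by positivity)).ne'
  have e : (fun y : ℝ => (gsp γ y : ℂ) * Complex.exp (-(r * y))) =
      indicator (Ioi 0) (fun y : ℝ => ((y:ℂ) ^ ((γ:ℂ) + 1 - 1) * Complex.exp (-((r:ℂ) * y))) / (Real.Gamma (γ + 1) : ℂ)) := by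
    funext y
    rcases lt_trichotomy y 0 with hy | hy | hy
    · rw [indicator_of_notMem (by simpa using hy.le), gsp_neg _ _ hy]; simp
    · subst hy; simp [gsp, Real.zero_rpow hγ.ne']
    · rw [indicator_of_mem (by exact hy), gsp, if_pos hy.le]
      push_cast
      rw [Complex.ofReal_cpow hy.le, add_sub_cancel_right]
      ring
  have g1 : (Real.Gamma (γ + 1) : ℂ) = Complex.Gamma (γ + 1) := by
      rw [← Complex.Gamma_ofReal]; push_cast; rfl
  have hG' : Complex.Gamma (γ + 1) ≠ 0 := by rw [← g1]; exact_mod_cast hG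
  have v : ∫ y : ℝ, (gsp γ y : ℂ) * Complex.exp (-(r * y)) = (1 / (r : ℂ)) ^ ((γ : ℂ) + 1) := by
    rw [e, integral_indicator measurableSet_Ioi, integral_div, h, g1]
    field_simp
  refine ⟨?_, v⟩
  by_contra hc
  rw [integral_undef hc] at v
  have hr0 : r ≠ 0 := hr.ne'
  have : (1 / (r : ℂ)) ^ ((γ : ℂ) + 1) ≠ 0 := by
    rw [Ne, Complex.cpow_eq_zero_iff]; simp [hr0]
  exact this v.symm

lemma gsp_nonneg (γ : ℝ) (hγ : 0 < γ) (x : ℝ) : 0 ≤ gsp γ x := by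
  rw [gsp_eq_max γ hγ]
  have := Real.Gamma_pos_of_pos (show 0 < γ + 1 by linarith)
  positivity

open ProbabilityTheory in
lemma laplace (γ : ℝ) (hγ : 0 < γ) (r : ℂ) (hr : 0 < r.re) :
    Integrable (fun y : ℝ => (gsp γ y : ℂ) * Complex.exp (-(r * y))) ∧
    ∫ y : ℝ, (gsp γ y : ℂ) * Complex.exp (-(r * y)) = (1 / r) ^ ((γ : ℂ) + 1) := by
  have hm : Measurable (fun x => (gsp γ x).toNNReal) := (gsp_cont γ hγ).measurable.real_toNNReal
  set μ : Measure ℝ := volume.withDensity (fun x => ((gsp γ x).toNNReal : ENNReal)) with hμ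
  have hco : ∀ x, ((gsp γ x).toNNReal : ℝ) = gsp γ x := fun x => Real.coe_toNNReal _ (gsp_nonneg γ hγ x)
  have hM : ∀ z : ℂ, complexMGF id μ z = ∫ y : ℝ, (gsp γ y : ℂ) * Complex.exp (z * y) := by
    intro z
    rw [complexMGF, hμ, integral_withDensity_eq_integral_smul hm]
    refine integral_congr_ae (Eventually.of_forall fun y => ?_)
    simp only [NNReal.smul_def, hco, Complex.real_smul, id]
  have hS : Iio 0 ⊆ interior (integrableExpSet id μ) := by
    refine interior_maximal ?_ isOpen_Iio
    intro t ht
    have ht : t < 0 := ht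
    change Integrable (fun y : ℝ => Real.exp (t * y)) μ
    rw [hμ, integrable_withDensity_iff_integrable_coe_smul hm]
    have := (laplace_real γ hγ (-t) (by linarith)).1.re
    refine this.congr (Eventually.of_forall fun y => ?_)
    simp only [hco, smul_eq_mul]
    rw [show -(((-t : ℝ) : ℂ) * y) = ((t * y : ℝ) : ℂ) by push_cast; ring, ← Complex.ofReal_exp,
      ← Complex.ofReal_mul]
    exact Complex.ofReal_re _
  let U : Set ℂ := {z | z.re < 0}
  have hU : IsOpen U := isOpen_lt Complex.continuous_re continuous_const
  have a1 : AnalyticOnNhd ℂ (complexMGF id μ) U := analyticOnNhd_complexMGF.mono fun z hz => hS hz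
  have a2 : AnalyticOnNhd ℂ (fun z : ℂ => (1 / (-z)) ^ ((γ : ℂ) + 1)) U := by
    refine DifferentiableOn.analyticOnNhd (fun z hz => DifferentiableAt.differentiableWithinAt ?_) hU
    have hz : z.re < 0 := hz
    have hz0 : -z ≠ 0 := by
      intro h
      have : z = 0 := by simpa using h
      simp [this] at hz
    refine DifferentiableAt.cpow ((differentiableAt_const _).div differentiableAt_id.neg hz0)
      (differentiableAt_const _) ?_
    left
    rw [one_div, Complex.inv_re]
    have : 0 < Complex.normSq (-z) := Complex.normSq_pos.2 hz0
    have h2 : 0 < (-z).re := by simpa using hz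
    positivity
  have hUc : IsPreconnected U := (convex_halfSpace_re_lt 0).isPreconnected
  have heq : EqOn (complexMGF id μ) (fun z : ℂ => (1 / (-z)) ^ ((γ : ℂ) + 1)) U := by
    refine a1.eqOn_of_preconnected_of_frequently_eq a2 hUc (z₀ := -1) (by simp [U]) ?_
    have ht : Tendsto (fun t : ℝ => (-(t : ℂ))) (𝓝[≠] 1) (𝓝[≠] (-1)) := by
      refine tendsto_nhdsWithin_iff.2 ⟨?_, ?_⟩
      · have : Continuous (fun t : ℝ => (-(t : ℂ))) := by fun_prop
        simpa using (this.tendsto 1).mono_left nhdsWithin_le_nhds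
      · filter_upwards [self_mem_nhdsWithin] with t ht
        intro h
        apply ht
        have h' : -(t : ℂ) = -1 := h
        exact_mod_cast neg_injective h'
    refine ht.frequently (Eventually.frequently ?_)
    filter_upwards [nhdsWithin_le_nhds (lt_mem_nhds (show (0:ℝ) < 1 by norm_num))] with t ht
    rw [hM]
    simp only [neg_neg, neg_mul]
    exact (laplace_real γ hγ t ht).2
  have v : ∫ y : ℝ, (gsp γ y : ℂ) * Complex.exp (-(r * y)) = (1 / r) ^ ((γ : ℂ) + 1) := by
    have := heq (x := -r) (by simpa [U] using hr)
    rw [hM] at this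
    simpa only [neg_neg, neg_mul] using this
  refine ⟨?_, v⟩
  by_contra hc
  rw [integral_undef hc] at v
  have hr0 : r ≠ 0 := by rintro rfl; simp at hr
  have : (1 / r) ^ ((γ : ℂ) + 1) ≠ 0 := by
    rw [Ne, Complex.cpow_eq_zero_iff]; simp [hr0]
  exact this v.symm

lemma F_int (p : ℕ) (α : ℝ) (hα0 : 0 ≤ α) (hαp : α < p) :
    Integrable (nab (p + 1) (gsp (p - α))) := by
  set F := nab (p + 1) (gsp (p - α)) with hF
  have hc : Continuous F := nab_cont _ _ (gsp_cont _ (by linarith))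
  have h1 : IntegrableOn F (Iio 0) :=
    (integrableOn_zero).congr_fun (fun x hx => (nab_neg _ _ (gsp_neg _) x hx).symm) measurableSet_Iio
  have h2 : IntegrableOn F (Icc 0 (p + 2)) := hc.integrableOn_Icc
  have h3 : IntegrableOn F (Ioi (p + 2)) := by
    have hb : ∀ x ∈ Ioi ((p:ℝ) + 2), ‖F x‖ ≤ (x - (p + 1)) ^ (-α - 1) / |Real.Gamma (-α)| := by
      intro x hx
      have hx : (p:ℝ) + 2 < x := hx
      have := nab_bound (p + 1) (p - α) x (by push_cast; linarith) (by push_cast; linarith)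
      push_cast at this
      rw [show (p:ℝ) - α - (p + 1) = -α - 1 by ring, sub_add_cancel] at this
      exact this
    refine Integrable.mono' (g := fun x => (x - (p + 1)) ^ (-α - 1) / |Real.Gamma (-α)|) ?_
      hc.aestronglyMeasurable ((ae_restrict_iff' measurableSet_Ioi).2 (Eventually.of_forall hb))
    rcases hα0.eq_or_lt with h | h
    · subst h; simp
    · refine Integrable.div_const ?_ _
      have := integrableOn_add_rpow_Ioi_of_lt (a := -α - 1) (m := -((p:ℝ) + 1)) (c := p + 2) (by linarith) (by linarith)
      simp only [← sub_eq_add_neg] at this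
      exact this
  rw [← integrableOn_univ]
  refine ((h1.union h2).union h3).mono_set fun x _ => ?_
  rcases lt_or_ge x 0 with h | h
  · exact Or.inl (Or.inl h)
  · rcases le_or_gt x (p + 2) with h' | h'
    · exact Or.inl (Or.inr ⟨h, h'⟩)
    · exact Or.inr h'

lemma iThetaPow_eq (θ α : ℝ) (hθ : θ ≠ 0) : iThetaPow θ α = (Complex.I * θ) ^ (α : ℂ) := by
  have h0 : Complex.I * θ ≠ 0 := by simp [hθ]
  have hn : ‖Complex.I * θ‖ = |θ| := by simp
  have ha : Complex.arg (Complex.I * θ) = Real.pi / 2 * Real.sign θ := by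
    rcases lt_or_gt_of_ne hθ with h | h
    · rw [Real.sign_of_neg h, Complex.arg_eq_neg_pi_div_two_iff.2 (by simp [h])]; ring
    · rw [Real.sign_of_pos h, Complex.arg_eq_pi_div_two_iff.2 (by simp [h])]; ring
  rw [iThetaPow, Complex.cpow_def_of_ne_zero h0, Complex.log, hn, ha,
    Real.rpow_def_of_pos (abs_pos.2 hθ)]
  push_cast
  rw [← Complex.exp_add]
  congr 1; ring

theorem stmt0 (p : ℕ) (hp : 1 ≤ p) (α : ℝ) (hα0 : 0 ≤ α) (hαp : α < p)
    (θ : ℝ) (hθ : θ ≠ 0) :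
    (∫ x : ℝ, (fracDerivLeft α (cardinalBSpline p) x : ℂ)
        * Complex.exp (-(Complex.I * (θ : ℂ) * (x : ℂ))))
      = iThetaPow θ α
          * ((1 - Complex.exp (-(Complex.I * (θ : ℂ)))) / (Complex.I * (θ : ℂ))) ^ (p + 1) := by
  have h0 : Complex.I * (θ:ℂ) ≠ 0 := by simp [hθ]
  simp only [frac_eq p α hα0 hαp]
  set F := nab (p + 1) (gsp (p - α)) with hF
  have hγ : 0 < (p:ℝ) - α := by linarith
  have hc : Continuous F := nab_cont _ _ (gsp_cont _ hγ)
  have hr : Tendsto (fun ε : ℝ => (ε : ℂ) + Complex.I * θ) (𝓝[>] 0) (𝓝 (Complex.I * θ)) := by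
    have : Continuous (fun ε : ℝ => (ε : ℂ) + Complex.I * θ) := by fun_prop
    have := (this.tendsto 0).mono_left (nhdsWithin_le_nhds (s := Ioi 0))
    simpa using this
  have L1 : Tendsto (fun ε : ℝ => ∫ x : ℝ, (F x : ℂ) * Complex.exp (-(((ε : ℂ) + Complex.I * θ) * x)))
      (𝓝[>] 0) (𝓝 (∫ x : ℝ, (F x : ℂ) * Complex.exp (-(Complex.I * θ * x)))) := by
    refine tendsto_integral_filter_of_dominated_convergence (fun x => ‖F x‖) ?_ ?_
      (F_int p α hα0 hαp).norm ?_
    · refine Eventually.of_forall fun ε => Continuous.aestronglyMeasurable ?_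
      fun_prop
    · filter_upwards [self_mem_nhdsWithin] with ε hε
      refine Eventually.of_forall fun x => ?_
      rcases lt_or_ge x 0 with hx | hx
      · simp [hF, nab_neg _ _ (gsp_neg _) x hx]
      · rw [norm_mul, Complex.norm_exp, Complex.norm_real]
        refine mul_le_of_le_one_right (norm_nonneg _) ?_
        rw [Real.exp_le_one_iff]
        have : 0 ≤ ε * x := mul_nonneg (le_of_lt hε) hx
        simpa using this
    · refine Eventually.of_forall fun x => ?_
      have : Continuous (fun r : ℂ => (F x : ℂ) * Complex.exp (-(r * x))) := by fun_prop
      exact (this.tendsto (Complex.I * θ)).comp hr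
  have L2 : Tendsto (fun ε : ℝ => ∫ x : ℝ, (F x : ℂ) * Complex.exp (-(((ε : ℂ) + Complex.I * θ) * x)))
      (𝓝[>] 0) (𝓝 ((1 - Complex.exp (-(Complex.I * θ))) ^ (p + 1) *
        (1 / (Complex.I * θ)) ^ ((((p:ℝ) - α : ℝ) : ℂ) + 1))) := by
    have hca : ContinuousAt (fun r : ℂ => (1 - Complex.exp (-r)) ^ (p + 1) *
        (1 / r) ^ ((((p:ℝ) - α : ℝ) : ℂ) + 1)) (Complex.I * θ) := by
      refine ContinuousAt.mul (by fun_prop) (ContinuousAt.cpow ?_ continuousAt_const ?_)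
      · exact continuousAt_const.div continuousAt_id h0
      · right
        simp [hθ]
    refine (hca.tendsto.comp hr).congr' ?_
    filter_upwards [self_mem_nhdsWithin] with ε hε
    have hre : 0 < ((ε : ℂ) + Complex.I * θ).re := by simpa using hε
    have hl := laplace _ hγ _ hre
    rw [hF, (nab_exp (p + 1) _ _ hl.1).2, hl.2]
    rfl
  rw [tendsto_nhds_unique L1 L2, iThetaPow_eq θ α hθ, div_pow]
  have harg : Complex.arg (Complex.I * θ) ≠ Real.pi := by
    rw [Ne, Complex.arg_eq_pi_iff]; simp [hθ]
  have : (1 / (Complex.I * θ)) ^ ((((p:ℝ) - α : ℝ) : ℂ) + 1) =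
      (Complex.I * θ) ^ (α : ℂ) * ((Complex.I * θ) ^ (p + 1))⁻¹ := by
    rw [one_div, Complex.inv_cpow _ _ harg, ← Complex.cpow_neg, ← Complex.cpow_natCast,
      ← Complex.cpow_neg, ← Complex.cpow_add _ _ h0]
    congr 1; push_cast; ring
  rw [this]; ring
end

section
/- Let p ≥ 1 be an integer and let α be a real number with 0 ≤ α < p. Then for every θ ∈ ℝ with θ ≠ 0, the Fourier transform of the right Riemann–Liouville fractional derivative of the cardinal B-spline φ_p satisfies ∫_ℝ (D₊^α φ_p)(x) e^{-iθx} dx = (-iθ)^α · ((1 - e^{-iθ})/(iθ))^{p+1}, where (-iθ)^α denotes the principal complex power |θ|^α e^{-i(π/2)sign(θ)α}. -/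
open MeasureTheory

/-- Right Riemann–Liouville fractional derivative on the real line. -/
noncomputable def fracDerivRight (α : ℝ) (u : ℝ → ℝ) (x : ℝ) : ℝ :=
  ((-1 : ℝ) ^ (⌊α⌋₊ + 1) / Real.Gamma ((⌊α⌋₊ : ℝ) + 1 - α)) *
    iteratedDeriv (⌊α⌋₊ + 1)
      (fun z => ∫ y in Set.Ici z, (y - z) ^ ((⌊α⌋₊ : ℝ) + 1 - α - 1) * u y) x

/-- Principal complex power `(-iθ)^α = |θ|^α e^{-i (π/2) sign(θ) α}`. -/
noncomputable def negIThetaPow (θ α : ℝ) : ℂ :=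
  ((|θ| ^ α : ℝ) : ℂ) * Complex.exp (-(Complex.I * (Real.pi / 2) * Real.sign θ * α))


open Set Filter Topology

/-- normalized truncated power -/
noncomputable def tpow (q : ℝ) (s : ℝ) : ℝ := if 0 < s then s ^ q / Real.Gamma (q + 1) else 0

lemma laplace_integrable (q : ℝ) (hq : 0 < q) (w : ℂ) (hw : 0 < w.re) :
    IntegrableOn (fun t : ℝ => ((t ^ q : ℝ) : ℂ) * Complex.exp (-(w * t))) (Ioi 0) := by
  have h := integrableOn_rpow_mul_exp_neg_mul_rpow (p := 1) (s := q) (b := w.re) (by linarith) one_pos hw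
  refine Integrable.mono' h ?_ ?_
  · refine ContinuousOn.aestronglyMeasurable ?_ measurableSet_Ioi
    apply ContinuousOn.mul
    · exact (Complex.continuous_ofReal.comp (Real.continuous_rpow_const hq.le)).continuousOn
    · fun_prop
  · refine (ae_restrict_iff' measurableSet_Ioi).2 (Eventually.of_forall fun t ht => ?_)
    have ht : 0 < t := ht
    simp [Complex.norm_exp, abs_of_nonneg (Real.rpow_nonneg ht.le q)]

lemma laplace_real_s1 (q : ℝ) (hq : 0 < q) (r : ℝ) (hr : 0 < r) :
    ∫ t : ℝ in Ioi 0, ((t ^ q : ℝ) : ℂ) * Complex.exp (-((r : ℂ) * t))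
      = (1 / (r : ℂ)) ^ ((q + 1 : ℝ) : ℂ) * (Real.Gamma (q + 1) : ℂ) := by
  have h := Complex.integral_cpow_mul_exp_neg_mul_Ioi (a := ((q + 1 : ℝ) : ℂ)) (r := r)
    (by simp; linarith) hr
  rw [Complex.Gamma_ofReal] at h
  rw [← h]
  refine setIntegral_congr_fun measurableSet_Ioi fun t ht => ?_
  have ht : 0 < t := ht
  rw [Complex.ofReal_cpow ht.le]
  congr 2
  push_cast; ring

lemma laplace_complex (q : ℝ) (hq : 0 < q) (w : ℂ) (hw : 0 < w.re) :
    ∫ t : ℝ in Ioi 0, ((t ^ q : ℝ) : ℂ) * Complex.exp (-(w * t))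
      = (1 / w) ^ ((q + 1 : ℝ) : ℂ) * (Real.Gamma (q + 1) : ℂ) := by
  have hopen : IsOpen {w : ℂ | 0 < w.re} := isOpen_lt continuous_const Complex.continuous_re
  have hconv : IsPreconnected {w : ℂ | 0 < w.re} :=
    (convex_halfSpace_re_gt 0).isPreconnected
  have hf : AnalyticOnNhd ℂ (fun w : ℂ => ∫ t : ℝ in Ioi 0, ((t ^ q : ℝ) : ℂ) * Complex.exp (-(w * t)))
      {w : ℂ | 0 < w.re} := by
    apply DifferentiableOn.analyticOnNhd _ hopen
    intro w0 hw0
    have hw0 : 0 < w0.re := hw0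
    apply DifferentiableAt.differentiableWithinAt
    have hball : {w : ℂ | w0.re / 2 < w.re} ∈ 𝓝 w0 :=
      (isOpen_lt continuous_const Complex.continuous_re).mem_nhds (by change w0.re / 2 < w0.re; linarith)
    have h := hasDerivAt_integral_of_dominated_loc_of_deriv_le (𝕜 := ℂ) (μ := volume.restrict (Ioi (0:ℝ)))
      (F := fun (w : ℂ) (t : ℝ) => ((t ^ q : ℝ) : ℂ) * Complex.exp (-(w * t)))
      (F' := fun (w : ℂ) (t : ℝ) => ((t ^ q : ℝ) : ℂ) * (Complex.exp (-(w * t)) * (-t)))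
      (bound := fun t : ℝ => t ^ (q + 1) * Real.exp (-(w0.re / 2) * t ^ (1:ℝ)))
      hball ?_ (laplace_integrable q hq w0 hw0) ?_ ?_ ?_ ?_
    · exact h.2.differentiableAt
    · filter_upwards [hball] with w hw
      exact (laplace_integrable q hq w (by change w0.re / 2 < w.re at hw; linarith)).aestronglyMeasurable
    · refine ContinuousOn.aestronglyMeasurable ?_ measurableSet_Ioi
      apply ContinuousOn.mul
      · exact (Complex.continuous_ofReal.comp (Real.continuous_rpow_const hq.le)).continuousOn
      · fun_prop
    · refine (ae_restrict_iff' measurableSet_Ioi).2 (Eventually.of_forall fun t ht w hw => ?_)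
      have ht : 0 < t := ht
      have hw : w0.re / 2 < w.re := hw
      rw [Real.rpow_add_one ht.ne']
      simp only [norm_mul, Complex.norm_exp, norm_neg, Complex.norm_real, Real.norm_eq_abs, 
        abs_of_nonneg (Real.rpow_nonneg ht.le q), abs_of_pos ht, Real.rpow_one]
      have : Real.exp ((-(w * t)).re) ≤ Real.exp (-(w0.re / 2) * t) := by
        apply Real.exp_le_exp.2
        simp
        nlinarith
      calc _ = (t ^ q * t) * Real.exp ((-(w * t)).re) := by ring
        _ ≤ _ := by gcongr
    · exact integrableOn_rpow_mul_exp_neg_mul_rpow (by linarith) one_pos (by linarith)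
    · refine Eventually.of_forall fun t w hw => ?_
      apply HasDerivAt.const_mul
      have : HasDerivAt (fun w : ℂ => -(w * (t:ℂ))) (-t) w := by
        simpa only [one_mul] using! ((hasDerivAt_id w).mul_const (t:ℂ)).neg
      exact this.cexp
  have hg : AnalyticOnNhd ℂ (fun w : ℂ => (1 / w) ^ ((q + 1 : ℝ) : ℂ) * (Real.Gamma (q + 1) : ℂ))
      {w : ℂ | 0 < w.re} := by
    apply DifferentiableOn.analyticOnNhd _ hopen
    intro w0 hw0
    have hw0 : 0 < w0.re := hw0
    have hne : w0 ≠ 0 := by rintro rfl; simp at hw0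
    apply DifferentiableAt.differentiableWithinAt
    apply DifferentiableAt.mul_const
    apply DifferentiableAt.cpow_const
    · exact (differentiableAt_const (1 : ℂ)).div differentiableAt_id hne
    · left
      change 0 < (1 / w0).re
      rw [one_div, Complex.inv_re]
      have := Complex.normSq_pos.2 hne
      positivity
  refine hf.eqOn_of_preconnected_of_frequently_eq hg hconv (z₀ := 1) (by simp) ?_ hw
  have hT : Tendsto (fun n : ℕ => ((1 + 1 / ((n:ℝ) + 1) : ℝ) : ℂ)) atTop (𝓝[≠] 1) := by
    apply tendsto_nhdsWithin_of_tendsto_nhds_of_eventually_within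
    · have := (tendsto_one_div_add_atTop_nhds_zero_nat (𝕜 := ℝ)).const_add 1
      simpa [Function.comp_def] using (Complex.continuous_ofReal.tendsto _).comp this
    · refine Eventually.of_forall fun n => ?_
      have : (0:ℝ) < 1 / ((n:ℝ) + 1) := by positivity
      intro h
      change _ = (1 : ℂ) at h
      have : (1 + 1 / ((n:ℝ) + 1) : ℝ) = 1 := by exact_mod_cast h
      linarith
  refine hT.frequently (Frequently.of_forall fun n => ?_)
  exact laplace_real_s1 q hq _ (by positivity)

lemma tpow_integrable (q : ℝ) (hq : 0 < q) (w : ℂ) (hw : 0 < w.re) :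
    Integrable (fun t : ℝ => ((tpow q t : ℝ) : ℂ) * Complex.exp (-(w * t))) := by
  have h := ((laplace_integrable q hq w hw).div_const (Real.Gamma (q + 1) : ℂ))
  replace h := (integrable_indicator_iff measurableSet_Ioi).2 h
  refine h.congr (Eventually.of_forall fun t => ?_)
  by_cases ht : 0 < t
  · simp [tpow, ht]; ring
  · simp [tpow, ht]

lemma tpow_laplace (q : ℝ) (hq : 0 < q) (w : ℂ) (hw : 0 < w.re) :
    ∫ t : ℝ, ((tpow q t : ℝ) : ℂ) * Complex.exp (-(w * t)) = (1 / w) ^ ((q + 1 : ℝ) : ℂ) := by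
  have hG : (Real.Gamma (q + 1) : ℂ) ≠ 0 := by
    exact_mod_cast (Real.Gamma_pos_of_pos (by linarith : 0 < q + 1)).ne'
  have h := laplace_complex q hq w hw
  have h2 : (∫ t : ℝ, ((tpow q t : ℝ) : ℂ) * Complex.exp (-(w * t)))
      = (∫ t : ℝ in Ioi 0, ((t ^ q : ℝ) : ℂ) * Complex.exp (-(w * t))) / (Real.Gamma (q + 1) : ℂ) := by
    rw [← integral_div, ← integral_indicator measurableSet_Ioi]
    congr 1
    ext t
    by_cases ht : 0 < t
    · simp [tpow, ht]; ring
    · simp [tpow, ht]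
  rw [h2, h, mul_div_cancel_right₀ _ hG]

lemma fwd_laplace (f : ℝ → ℝ) (w L : ℂ) (n : ℕ)
    (hi : Integrable (fun t : ℝ => (f t : ℂ) * Complex.exp (-(w * t))))
    (hL : ∫ t : ℝ, (f t : ℂ) * Complex.exp (-(w * t)) = L) :
    Integrable (fun t : ℝ => (((fwdDiff 1)^[n] f t : ℝ) : ℂ) * Complex.exp (-(w * t))) ∧
    ∫ t : ℝ, (((fwdDiff 1)^[n] f t : ℝ) : ℂ) * Complex.exp (-(w * t)) = (Complex.exp w - 1) ^ n * L := by
  induction n with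
  | zero => simp [hi, hL]
  | succ n ih =>
    obtain ⟨h1, h2⟩ := ih
    simp only [Function.iterate_succ_apply']
    set g := (fwdDiff (1:ℝ))^[n] f
    have e : ∀ t : ℝ, ((fwdDiff 1 g t : ℝ) : ℂ) * Complex.exp (-(w * t))
      = Complex.exp w * ((g (t + 1) : ℂ) * Complex.exp (-(w * (t + 1 : ℝ))))
        - (g t : ℂ) * Complex.exp (-(w * t)) := by
      intro t
      have : Complex.exp (-(w * t)) = Complex.exp w * Complex.exp (-(w * (t + 1 : ℝ))) := by
        rw [← Complex.exp_add]; congr 1; push_cast; ring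
      rw [fwdDiff]; push_cast
      rw [sub_mul]; congr 1
      rw [this]; push_cast; ring
    have h1' := (h1.comp_add_right 1).const_mul (Complex.exp w)
    simp_rw [e]
    refine ⟨h1'.sub h1, ?_⟩
    rw [integral_sub h1' h1, integral_const_mul,
      integral_add_right_eq_self (fun t : ℝ => (g t : ℂ) * Complex.exp (-(w * t))), h2]
    ring

lemma tpow_hasDerivAt (q : ℝ) (hq : 1 < q) (s : ℝ) : HasDerivAt (tpow q) (tpow (q - 1) s) s := by
  have e : tpow q = fun s => (max s 0) ^ q / Real.Gamma (q + 1) := by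
    ext s; unfold tpow; split_ifs with h
    · rw [max_eq_left h.le]
    · rw [max_eq_right (by linarith), Real.zero_rpow (by linarith)]; simp
  have hG : Real.Gamma (q + 1) = q * Real.Gamma q := Real.Gamma_add_one (by linarith)
  have hGp : 0 < Real.Gamma q := Real.Gamma_pos_of_pos (by linarith)
  rcases lt_trichotomy s 0 with h | h | h
  · have : tpow q =ᶠ[𝓝 s] fun _ => 0 := by
      filter_upwards [Iio_mem_nhds h] with x hx
      have : x < 0 := hx
      simp [tpow, this.not_gt]
    simp only [tpow, h.not_gt, if_false]
    exact (hasDerivAt_const s (0:ℝ)).congr_of_eventuallyEq this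
  · subst h
    have h0 : tpow (q - 1) 0 = 0 := by simp [tpow]
    rw [h0, hasDerivAt_iff_isLittleO_nhds_zero]
    have h00 : tpow q 0 = 0 := by simp [tpow]
    simp only [zero_add, h00, smul_zero, sub_zero]
    rw [Asymptotics.isLittleO_iff_tendsto' (by
      filter_upwards with x hx; subst hx; exact h00)]
    have hb : Tendsto (fun x : ℝ => |x| ^ (q - 1) / Real.Gamma (q + 1)) (𝓝 0) (𝓝 0) := by
      have : Continuous (fun x : ℝ => |x| ^ (q - 1) / Real.Gamma (q + 1)) :=
        ((continuous_abs).rpow_const (fun _ => Or.inr (by linarith))).div_const _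
      have := this.tendsto 0
      simpa [Real.zero_rpow (by linarith : q - 1 ≠ 0)] using this
    refine squeeze_zero_norm (fun x => ?_) hb
    unfold tpow
    have hGp' : 0 < Real.Gamma (q + 1) := by rw [hG]; positivity
    split_ifs with hx
    · rw [abs_of_pos hx, Real.rpow_sub_one hx.ne', Real.norm_of_nonneg (by positivity)]
      apply le_of_eq; ring
    · simp; positivity
  · have : tpow q =ᶠ[𝓝 s] fun s => s ^ q / Real.Gamma (q + 1) := by
      filter_upwards [Ioi_mem_nhds h] with x hx
      have : 0 < x := hx
      simp [tpow, this]
    have h2 := ((Real.hasDerivAt_rpow_const (x := s) (p := q) (Or.inl h.ne')).div_const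
      (Real.Gamma (q + 1))).congr_of_eventuallyEq this
    have e3 : tpow (q - 1) s = q * s ^ (q - 1) / Real.Gamma (q + 1) := by
      rw [tpow, if_pos h, hG, sub_add_cancel]
      field_simp
    rw [e3]
    exact h2

lemma fwd_hasDerivAt (f f' : ℝ → ℝ) (h : ∀ s, HasDerivAt f (f' s) s) (n : ℕ) (s : ℝ) :
    HasDerivAt ((fwdDiff 1)^[n] f) ((fwdDiff 1)^[n] f' s) s := by
  induction n generalizing f f' with
  | zero => exact h s
  | succ n ih =>
    simp only [Function.iterate_succ_apply]
    exact ih _ _ fun s => ((h (s + 1)).comp_add_const s 1).sub (h s)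

lemma iter_deriv_s1 (n m : ℕ) (q : ℝ) (hq : 0 < q) (x : ℝ) :
    iteratedDeriv m (fun z => (fwdDiff 1)^[n] (tpow (q + m)) (-z)) x
      = (-1) ^ m * (fwdDiff 1)^[n] (tpow q) (-x) := by
  induction m generalizing q x with
  | zero => simp
  | succ m ih =>
    rw [iteratedDeriv_succ]
    have : (iteratedDeriv m fun z => (fwdDiff 1)^[n] (tpow (q + (m + 1 : ℕ))) (-z))
      = fun x => (-1) ^ m * (fwdDiff 1)^[n] (tpow (q + 1)) (-x) := by
      ext x
      rw [← ih (q + 1) (by linarith)]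
      have e : q + ((m + 1 : ℕ) : ℝ) = q + 1 + m := by push_cast; ring
      rw [e]
    rw [this]
    have hd := fwd_hasDerivAt _ _ (tpow_hasDerivAt (q + 1) (by linarith)) n (-x)
    have hd2 := (HasDerivAt.scomp x hd (hasDerivAt_neg x)).const_mul ((-1:ℝ) ^ m)
    simp only [add_sub_cancel_right] at hd2
    have := hd2.deriv
    simp only [Function.comp_def] at this
    rw [this, pow_succ]; simp

lemma fwd_mul_id (f : ℝ → ℝ) (n : ℕ) (s : ℝ) :
    (fwdDiff 1)^[n + 1] (fun s => s * f s) s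
      = (s + (n + 1)) * (fwdDiff 1)^[n + 1] f s + (n + 1) * (fwdDiff 1)^[n] f s := by
  induction n generalizing s with
  | zero => simp [fwdDiff]; ring
  | succ n ih =>
    rw [Function.iterate_succ_apply']
    have e : (fwdDiff (1:ℝ))^[n + 1] (fun s => s * f s) = fun s => (s + (n + 1)) * (fwdDiff 1)^[n + 1] f s + (n + 1) * (fwdDiff 1)^[n] f s := funext ih
    rw [e]
    rw [Function.iterate_succ_apply' (fwdDiff (1:ℝ)) (n+1) f]
    have e2 : ∀ s, (fwdDiff (1:ℝ))^[n + 1] f s = (fwdDiff (1:ℝ))^[n] f (s + 1) - (fwdDiff (1:ℝ))^[n] f s := by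
      intro s; rw [Function.iterate_succ_apply']; rfl
    simp only [fwdDiff, e2]
    push_cast; ring

lemma bspline_eq_s1 (p : ℕ) (t : ℝ) :
    cardinalBSpline p t = (fwdDiff 1)^[p + 1] (tpow p) (-t) := by
  induction p generalizing t with
  | zero =>
    simp only [cardinalBSpline, zero_add, Function.iterate_one, fwdDiff, tpow]
    simp
    split_ifs <;> first | linarith | grind
  | succ p ih =>
    have e : tpow ((p + 1 : ℕ) : ℝ) = (1 / ((p:ℝ) + 1)) • (fun s => s * tpow p s) := by
      ext s
      simp only [tpow, Pi.smul_apply, smul_eq_mul]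
      split_ifs with h
      · have h1 : Real.Gamma (((p + 1 : ℕ) : ℝ) + 1) = (p + 1) * Real.Gamma (p + 1) := by
          push_cast; exact Real.Gamma_add_one (by positivity)
        have : 0 < Real.Gamma ((p:ℝ) + 1) := Real.Gamma_pos_of_pos (by positivity)
        rw [h1, Nat.cast_add_one, Real.rpow_add_one h.ne']
        field_simp
      · simp
    rw [e, fwdDiff_iter_const_smul, Pi.smul_apply, fwd_mul_id]
    rw [cardinalBSpline]
    beta_reduce
    rw [ih, ih, Function.iterate_succ_apply' (fwdDiff (1:ℝ)) (p+1)]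
    have : -(t - 1) = -t + 1 := by ring
    rw [this]
    simp only [fwdDiff, smul_eq_mul]
    push_cast
    field_simp
    ring


lemma beta_real (β : ℝ) (hβ : 0 < β) (p : ℕ) (a : ℝ) (ha : 0 < a) :
    IntegrableOn (fun t : ℝ => t ^ (β - 1) * ((a - t) ^ p / Real.Gamma (p + 1))) (Ioo 0 a) ∧
    ∫ t in Ioo 0 a, t ^ (β - 1) * ((a - t) ^ p / Real.Gamma (p + 1))
      = Real.Gamma β * (a ^ (p + β) / Real.Gamma (p + β + 1)) := by
  have hG1 : Real.Gamma ((p:ℝ) + 1) ≠ 0 := (Real.Gamma_pos_of_pos (by positivity)).ne'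
  have hG2 : Real.Gamma ((p:ℝ) + β + 1) ≠ 0 := (Real.Gamma_pos_of_pos (by positivity)).ne'
  constructor
  · rw [← integrableOn_Ioc_iff_integrableOn_Ioo, ← intervalIntegrable_iff_integrableOn_Ioc_of_le ha.le]
    apply IntervalIntegrable.mul_continuousOn
    · exact intervalIntegral.intervalIntegrable_rpow' (by linarith)
    · fun_prop
  · have hB := Complex.betaIntegral_scaled (β : ℂ) ((p:ℂ) + 1) ha
    have hΓ := Complex.Gamma_mul_Gamma_eq_betaIntegral (s := (β : ℂ)) (t := (p:ℂ) + 1)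
      (by simpa using hβ) (by simp; positivity)
    rw [intervalIntegral.integral_of_le ha.le, integral_Ioc_eq_integral_Ioo] at hB
    have e1 : ∫ t in Ioo 0 a, (t : ℂ) ^ ((β : ℂ) - 1) * ((a : ℂ) - t) ^ ((p : ℂ) + 1 - 1)
        = ((∫ t in Ioo 0 a, t ^ (β - 1) * (a - t) ^ p : ℝ) : ℂ) := by
      rw [← integral_complex_ofReal]
      refine setIntegral_congr_fun measurableSet_Ioo fun t ht => ?_
      simp only [add_sub_cancel_right, Complex.cpow_natCast]
      push_cast
      rw [Complex.ofReal_cpow ht.1.le]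
      push_cast; rfl
    rw [e1] at hB
    have e2 : (β : ℂ) + (p + 1) = ((p + β + 1 : ℝ) : ℂ) := by push_cast; ring
    have e3 : (p : ℂ) + 1 = ((p + 1 : ℝ) : ℂ) := by push_cast; ring
    rw [e2, e3, Complex.Gamma_ofReal, Complex.Gamma_ofReal, Complex.Gamma_ofReal] at hΓ
    rw [e2, e3, show ((p + β + 1 : ℝ) : ℂ) - 1 = ((p + β : ℝ) : ℂ) by push_cast; ring, 
      ← Complex.ofReal_cpow ha.le] at hB
    have key : (∫ t in Ioo 0 a, t ^ (β - 1) * (a - t) ^ p) * Real.Gamma (p + β + 1)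
        = a ^ (p + β) * (Real.Gamma β * Real.Gamma (p + 1)) := by
      have : (((∫ t in Ioo 0 a, t ^ (β - 1) * (a - t) ^ p) * Real.Gamma (p + β + 1) : ℝ) : ℂ)
        = ((a ^ (p + β) * (Real.Gamma β * Real.Gamma (p + 1)) : ℝ) : ℂ) := by
        rw [Complex.ofReal_mul, hB, Complex.ofReal_mul (a ^ (p + β)), Complex.ofReal_mul (Real.Gamma β), hΓ]
        ring
      exact_mod_cast this
    simp_rw [← mul_div_assoc]
    rw [integral_div]
    field_simp
    linarith

lemma beta_term (β : ℝ) (hβ : 0 < β) (p : ℕ) (z k : ℝ) :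
    IntegrableOn (fun y => (y - z) ^ (β - 1) * tpow p (-y + k)) (Ici z) ∧
    ∫ y in Ici z, (y - z) ^ (β - 1) * tpow p (-y + k) = Real.Gamma β * tpow (p + β) (-z + k) := by
  by_cases ha : 0 < -z + k
  · obtain ⟨h1, h2⟩ := beta_real β hβ p (-z + k) ha
    rw [← integrable_indicator_iff measurableSet_Ioo] at h1
    rw [← integral_indicator measurableSet_Ioo] at h2
    have e : (Ioi z).indicator (fun y => (y - z) ^ (β - 1) * tpow p (-y + k)) =
      fun y => (Ioo 0 (-z + k)).indicator (fun t : ℝ => t ^ (β - 1) * ((-z + k - t) ^ p / Real.Gamma (p + 1))) (y - z) := by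
      ext y
      by_cases hy : z < y
      · by_cases hk : y < k
        · have i1 : y - z ∈ Ioo 0 (-z + k) := ⟨by linarith, by linarith⟩
          rw [indicator_of_mem (show y ∈ Ioi z from hy), indicator_of_mem i1, tpow,
            if_pos (by linarith), Real.rpow_natCast]
          congr 3; ring
        · have i1 : y - z ∉ Ioo 0 (-z + k) := fun h => hk (by linarith [h.2])
          rw [indicator_of_mem (show y ∈ Ioi z from hy), indicator_of_notMem i1, tpow,
            if_neg (by linarith), mul_zero]
      · have i1 : y - z ∉ Ioo 0 (-z + k) := fun h => hy (by linarith [h.1])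
        rw [indicator_of_notMem (show y ∉ Ioi z from hy), indicator_of_notMem i1]
    rw [integrableOn_Ici_iff_integrableOn_Ioi, ← integrable_indicator_iff measurableSet_Ioi,
      integral_Ici_eq_integral_Ioi, ← integral_indicator measurableSet_Ioi, e]
    refine ⟨h1.comp_sub_right z, ?_⟩
    rw [integral_sub_right_eq_self (fun y => (Ioo 0 (-z + k)).indicator (fun t : ℝ => t ^ (β - 1) * ((-z + k - t) ^ p / Real.Gamma (p + 1))) y), h2, tpow, if_pos ha]
  · have e : EqOn (fun y => (y - z) ^ (β - 1) * tpow p (-y + k)) (fun _ => 0) (Ici z) := by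
      intro y hy
      have : z ≤ y := hy
      simp only [tpow]
      rw [if_neg (by linarith), mul_zero]
    refine ⟨integrableOn_zero.congr_fun e.symm measurableSet_Ici, ?_⟩
    rw [setIntegral_congr_fun measurableSet_Ici e, tpow, if_neg ha]
    simp

lemma frac_int (β : ℝ) (hβ : 0 < β) (p : ℕ) (z : ℝ) :
    ∫ y in Ici z, (y - z) ^ (β - 1) * cardinalBSpline p y
      = Real.Gamma β * (fwdDiff 1)^[p + 1] (tpow (p + β)) (-z) := by
  simp_rw [bspline_eq_s1, fwdDiff_iter_eq_sum_shift, Finset.mul_sum]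
  have e : ∀ (c : ℤ) (a b : ℝ), a * c • b = c * (a * b) := by
    intro c a b; rw [zsmul_eq_mul]; ring
  simp_rw [e]
  rw [integral_finsetSum]
  · refine Finset.sum_congr rfl fun k _ => ?_
    rw [integral_const_mul, (beta_term β hβ p z _).2]
  · intro k _
    exact (beta_term β hβ p z _).1.const_mul _

lemma fracDeriv_eq (p : ℕ) (α : ℝ) (hαp : α < p) (x : ℝ) :
    fracDerivRight α (cardinalBSpline p) x = (fwdDiff 1)^[p + 1] (tpow (p - α)) (-x) := by
  unfold fracDerivRight
  have hβ : 0 < (⌊α⌋₊ : ℝ) + 1 - α := by linarith [Nat.lt_floor_add_one α]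
  simp_rw [frac_int _ hβ]
  have hG := Real.Gamma_pos_of_pos hβ
  rw [iteratedDeriv_const_mul_field]
  have e : (p : ℝ) + ((⌊α⌋₊ : ℝ) + 1 - α) = (p - α) + ((⌊α⌋₊ + 1 : ℕ) : ℝ) := by push_cast; ring
  rw [e, iter_deriv_s1 _ _ _ (by linarith)]
  have h1 : ((-1:ℝ) ^ (⌊α⌋₊ + 1)) * (-1) ^ (⌊α⌋₊ + 1) = 1 := by
    rw [← mul_pow]; simp
  calc _ = (((-1:ℝ) ^ (⌊α⌋₊ + 1)) * (-1) ^ (⌊α⌋₊ + 1)) * (Real.Gamma ((⌊α⌋₊ : ℝ) + 1 - α) / Real.Gamma ((⌊α⌋₊ : ℝ) + 1 - α)) * (fwdDiff 1)^[p + 1] (tpow (p - α)) (-x) := by ring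
    _ = _ := by rw [h1, div_self hG.ne']; ring

lemma fwd_hasDerivAt_pos (f f' : ℝ → ℝ) (h : ∀ s, 0 < s → HasDerivAt f (f' s) s) (n : ℕ) (s : ℝ)
    (hs : 0 < s) :
    HasDerivAt ((fwdDiff 1)^[n] f) ((fwdDiff 1)^[n] f' s) s := by
  induction n generalizing f f' with
  | zero => exact h s hs
  | succ n ih =>
    simp only [Function.iterate_succ_apply]
    exact ih _ _ fun s hs => ((h (s + 1) (by linarith)).comp_add_const s 1).sub (h s hs)

lemma fwd_congr_pos (f g : ℝ → ℝ) (h : ∀ s, 0 < s → f s = g s) (n : ℕ) (s : ℝ) (hs : 0 < s) :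
    (fwdDiff 1)^[n] f s = (fwdDiff 1)^[n] g s := by
  induction n generalizing f g with
  | zero => exact h s hs
  | succ n ih =>
    simp only [Function.iterate_succ_apply]
    exact ih _ _ fun s hs => by simp only [fwdDiff]; rw [h s hs, h (s + 1) (by linarith)]

lemma rpow_decay (n : ℕ) (γ : ℝ) (hγ : γ ≤ n) :
    ∃ C : ℝ, ∀ s : ℝ, 1 ≤ s → |(fwdDiff 1)^[n] (fun x : ℝ => x ^ γ) s| ≤ C * s ^ (γ - n) := by
  induction n generalizing γ with
  | zero =>
    refine ⟨1, fun s hs => ?_⟩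
    simp [abs_of_nonneg (Real.rpow_nonneg (by linarith : 0 ≤ s) γ)]
  | succ n ih =>
    obtain ⟨C, hC⟩ := ih (γ - 1) (by push_cast at hγ; linarith)
    have hC0 : 0 ≤ C := by have := (abs_nonneg _).trans (hC 1 le_rfl); simpa using this
    refine ⟨|γ| * C, fun s hs => ?_⟩
    have hd : ∀ x : ℝ, 0 < x → HasDerivAt ((fwdDiff 1)^[n] (fun x : ℝ => x ^ γ))
        (γ * (fwdDiff 1)^[n] (fun x : ℝ => x ^ (γ - 1)) x) x := by
      intro x hx
      have := fwd_hasDerivAt_pos (fun x : ℝ => x ^ γ) (γ • fun x : ℝ => x ^ (γ - 1))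
        (fun s hs => Real.hasDerivAt_rpow_const (Or.inl hs.ne')) n x hx
      rw [fwdDiff_iter_const_smul] at this
      exact this
    obtain ⟨ξ, hξ, hE⟩ := exists_hasDerivAt_eq_slope ((fwdDiff 1)^[n] (fun x : ℝ => x ^ γ))
      (fun x => γ * (fwdDiff 1)^[n] (fun x : ℝ => x ^ (γ - 1)) x) (by linarith : s < s + 1)
      (fun x hx => (hd x (by linarith [hx.1])).continuousAt.continuousWithinAt)
      (fun x hx => hd x (by linarith [hx.1]))
    rw [add_sub_cancel_left, div_one] at hE
    rw [Function.iterate_succ_apply', fwdDiff, ← hE, abs_mul, mul_assoc]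
    gcongr
    refine (hC ξ (by linarith [hξ.1])).trans ?_
    gcongr ?_ * ?_
    have : γ - ((n + 1 : ℕ) : ℝ) = γ - 1 - n := by push_cast; ring
    rw [this]
    exact Real.rpow_le_rpow_of_nonpos (by linarith) hξ.1.le (by push_cast at hγ; linarith)

lemma tpow_continuous (q : ℝ) (hq : 0 < q) : Continuous (tpow q) := by
  have e : tpow q = fun s => (max s 0) ^ q / Real.Gamma (q + 1) := by
    ext s; unfold tpow; split_ifs with h
    · rw [max_eq_left h.le]
    · rw [max_eq_right (by linarith), Real.zero_rpow (by linarith)]; simp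
  rw [e]
  exact ((continuous_id.max continuous_const).rpow_const (fun _ => Or.inr hq.le)).div_const _

lemma fwd_continuous (f : ℝ → ℝ) (hf : Continuous f) (n : ℕ) : Continuous ((fwdDiff 1)^[n] f) := by
  induction n generalizing f with
  | zero => exact hf
  | succ n ih =>
    simp only [Function.iterate_succ_apply]
    exact ih _ ((hf.comp (continuous_id.add continuous_const)).sub hf)

lemma fwd_tpow_zero (q : ℝ) (n : ℕ) (s : ℝ) (hs : s ≤ -n) : (fwdDiff 1)^[n] (tpow q) s = 0 := by
  rw [fwdDiff_iter_eq_sum_shift]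
  refine Finset.sum_eq_zero fun k hk => ?_
  have : (k : ℝ) ≤ n := by exact_mod_cast Nat.lt_succ_iff.1 (Finset.mem_range.1 hk)
  rw [tpow, if_neg (by simp; linarith), smul_zero]

lemma K_integrable (p : ℕ) (α : ℝ) (hα0 : 0 ≤ α) (hαp : α < p) :
    Integrable ((fwdDiff 1)^[p + 1] (tpow (p - α))) := by
  set K := (fwdDiff 1)^[p + 1] (tpow (p - α)) with hK
  have hc : Continuous K := fwd_continuous _ (tpow_continuous _ (by linarith)) _
  have h1 : IntegrableOn K (Iic (-((p + 1 : ℕ) : ℝ))) :=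
    integrableOn_zero.congr_fun (fun s hs => (fwd_tpow_zero _ _ s hs).symm) measurableSet_Iic
  have h2 : IntegrableOn K (Icc (-((p + 1 : ℕ) : ℝ)) 1) := hc.continuousOn.integrableOn_Icc
  have hpos : ∀ s : ℝ, 0 < s → K s = (1 / Real.Gamma (p - α + 1)) *
      (fwdDiff 1)^[p + 1] (fun x : ℝ => x ^ ((p:ℝ) - α)) s := by
    intro s hs
    rw [hK, fwd_congr_pos _ ((1 / Real.Gamma (p - α + 1)) • fun x : ℝ => x ^ ((p:ℝ) - α)) _ _ s hs,
      fwdDiff_iter_const_smul]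
    · rfl
    · intro s hs
      simp only [tpow, hs, if_true, Pi.smul_apply, smul_eq_mul]; ring
  have h3 : IntegrableOn K (Ioi 1) := by
    rcases hα0.eq_or_lt with h | h
    · refine integrableOn_zero.congr_fun (fun s hs => ?_) measurableSet_Ioi
      have hs : 1 < s := hs
      rw [hpos s (by linarith), ← h]
      simp only [sub_zero, Real.rpow_natCast]
      have := fwdDiff_iter_pow_eq_zero_of_lt (R := ℝ) (Nat.lt_succ_self p)
      rw [Nat.succ_eq_add_one] at this
      rw [this]; simp
    · obtain ⟨C, hC⟩ := rpow_decay (p + 1) (p - α) (by push_cast; linarith)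
      have hi := ((integrableOn_Ioi_rpow_of_lt (a := (p:ℝ) - α - (p + 1 : ℕ)) (c := 1)
        (by push_cast; linarith) one_pos).const_mul C).const_mul |1 / Real.Gamma (p - α + 1)|
      refine Integrable.mono' hi hc.aestronglyMeasurable ?_
      refine (ae_restrict_iff' measurableSet_Ioi).2 (Eventually.of_forall fun s hs => ?_)
      have hs : 1 < s := hs
      rw [hpos s (by linarith), norm_mul, Real.norm_eq_abs, Real.norm_eq_abs]
      gcongr
      exact hC s hs.le
  rw [← integrableOn_univ]
  have : (univ : Set ℝ) = Iic (-((p + 1 : ℕ) : ℝ)) ∪ Icc (-((p + 1 : ℕ) : ℝ)) 1 ∪ Ioi 1 := by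
    ext s; simp only [mem_univ, mem_union, mem_Iic, mem_Icc, mem_Ioi, true_iff]
    grind
  rw [this]
  exact (h1.union h2).union h3

lemma K_fourier (p : ℕ) (α : ℝ) (hα0 : 0 ≤ α) (hαp : α < p) (θ : ℝ) (hθ : θ ≠ 0) :
    ∫ s : ℝ, (((fwdDiff 1)^[p + 1] (tpow (p - α)) s : ℝ) : ℂ) * Complex.exp (-(-(Complex.I * θ) * s))
      = (Complex.exp (-(Complex.I * θ)) - 1) ^ (p + 1) *
        (1 / (-(Complex.I * θ))) ^ (((p - α) + 1 : ℝ) : ℂ) := by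
  have hKi := K_integrable p α hα0 hαp
  have hKc : Continuous ((fwdDiff 1)^[p + 1] (tpow (p - α))) :=
    fwd_continuous _ (tpow_continuous _ (by linarith)) _
  set W : ℝ → ℂ := fun ε => (ε : ℂ) - Complex.I * θ with hW
  have hWc : Continuous W := by fun_prop
  have hW0 : W 0 = -(Complex.I * θ) := by simp [hW]
  have hWre : ∀ ε, (W ε).re = ε := by intro ε; simp [hW]
  have hL : Tendsto (fun ε : ℝ => ∫ s : ℝ, (((fwdDiff 1)^[p + 1] (tpow (p - α)) s : ℝ) : ℂ) *
      Complex.exp (-(W ε * s))) (𝓝[>] 0) (𝓝 (∫ s : ℝ, (((fwdDiff 1)^[p + 1] (tpow (p - α)) s : ℝ) : ℂ)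
        * Complex.exp (-(W 0 * s)))) := by
    refine tendsto_integral_filter_of_dominated_convergence
      (fun s => |(fwdDiff 1)^[p + 1] (tpow (p - α)) s| * Real.exp (p + 1)) ?_ ?_ ?_ ?_
    · refine Eventually.of_forall fun ε => Continuous.aestronglyMeasurable ?_
      fun_prop
    · have : Ioo (0:ℝ) 1 ∈ 𝓝[>] (0:ℝ) := Ioo_mem_nhdsGT one_pos
      filter_upwards [this] with ε hε
      refine Eventually.of_forall fun s => ?_
      rw [norm_mul, Complex.norm_exp, Complex.norm_real, Real.norm_eq_abs]
      by_cases hs : s ≤ -((p + 1 : ℕ) : ℝ)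
      · rw [fwd_tpow_zero _ _ s hs]; simp
      · gcongr
        have : (-(W ε * s)).re = -(ε * s) := by simp [hW]
        rw [this]
        push_cast at hs
        push Not at hs
        nlinarith [hε.1, hε.2, (Nat.cast_nonneg p : (0:ℝ) ≤ p)]
    · exact hKi.abs.mul_const _
    · refine Eventually.of_forall fun s => ?_
      have : Continuous fun ε : ℝ => (((fwdDiff 1)^[p + 1] (tpow (p - α)) s : ℝ) : ℂ) *
        Complex.exp (-(W ε * s)) := by fun_prop
      exact (this.tendsto 0).mono_left nhdsWithin_le_nhds
  have hne : W 0 ≠ 0 := by rw [hW0]; simp [hθ]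
  have hR : Tendsto (fun ε : ℝ => (Complex.exp (W ε) - 1) ^ (p + 1) *
        (1 / W ε) ^ (((p - α) + 1 : ℝ) : ℂ)) (𝓝[>] 0) (𝓝 ((Complex.exp (W 0) - 1) ^ (p + 1) *
        (1 / W 0) ^ (((p - α) + 1 : ℝ) : ℂ))) := by
    have : ContinuousAt (fun ε : ℝ => (Complex.exp (W ε) - 1) ^ (p + 1) *
        (1 / W ε) ^ (((p - α) + 1 : ℝ) : ℂ)) 0 := by
      apply ContinuousAt.mul
      · fun_prop
      · apply ContinuousAt.cpow
        · exact continuousAt_const.div hWc.continuousAt hne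
        · exact continuousAt_const
        · right
          rw [hW0]
          simp [hθ, Complex.inv_im]
    exact this.tendsto.mono_left nhdsWithin_le_nhds
  have heq : (fun ε : ℝ => ∫ s : ℝ, (((fwdDiff 1)^[p + 1] (tpow (p - α)) s : ℝ) : ℂ) *
      Complex.exp (-(W ε * s))) =ᶠ[𝓝[>] 0] (fun ε : ℝ => (Complex.exp (W ε) - 1) ^ (p + 1) *
        (1 / W ε) ^ (((p - α) + 1 : ℝ) : ℂ)) := by
    filter_upwards [self_mem_nhdsWithin] with ε hε
    have hε' : 0 < (W ε).re := by rw [hWre]; exact hε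
    exact (fwd_laplace _ _ _ (p + 1) (tpow_integrable _ (by linarith) _ hε')
      (tpow_laplace _ (by linarith) _ hε')).2
  have := tendsto_nhds_unique (hL.congr' heq) hR
  rw [hW0] at this
  exact this

lemma cpow_ident (p : ℕ) (α θ : ℝ) (hθ : θ ≠ 0) :
    (1 / (-(Complex.I * θ))) ^ (((p - α) + 1 : ℝ) : ℂ)
      = negIThetaPow θ α * (1 / (-(Complex.I * θ))) ^ (p + 1) := by
  have hne : (1 / (-(Complex.I * θ)) : ℂ) ≠ 0 := by simp [hθ]
  have e : (((p - α) + 1 : ℝ) : ℂ) = ((p + 1 : ℕ) : ℂ) + (-α : ℂ) := by push_cast; ring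
  rw [e, Complex.cpow_add _ _ hne, Complex.cpow_natCast, mul_comm]
  congr 1
  have e2 : (1 / (-(Complex.I * θ)) : ℂ) = ((θ⁻¹ : ℝ) : ℂ) * Complex.I := by
    have : (θ : ℂ) ≠ 0 := by exact_mod_cast hθ
    push_cast
    field_simp
    simp
  have hlog : Complex.log (1 / (-(Complex.I * θ))) =
      ((-Real.log |θ| : ℝ) : ℂ) + Complex.I * (Real.pi / 2) * Real.sign θ := by
    rw [e2]
    rcases lt_or_gt_of_ne hθ with h | h
    · have h' : 0 < (-θ)⁻¹ := inv_pos.2 (by linarith)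
      have e3 : ((θ⁻¹ : ℝ) : ℂ) * Complex.I = (((-θ)⁻¹ : ℝ) : ℂ) * (-Complex.I) := by
        push_cast; rw [inv_neg]; ring
      rw [e3, Complex.log_ofReal_mul h' (by simp), Complex.log_neg_I, Real.sign_of_neg h,
        abs_of_neg h, Real.log_inv]
      push_cast; ring
    · rw [Complex.log_ofReal_mul (inv_pos.2 h) (by simp), Complex.log_I, Real.sign_of_pos h,
        abs_of_pos h, Real.log_inv]
      push_cast; ring
  rw [Complex.cpow_def_of_ne_zero hne, hlog, negIThetaPow, Real.rpow_def_of_pos (abs_pos.2 hθ),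
    Complex.ofReal_exp, ← Complex.exp_add]
  congr 1
  push_cast; ring

theorem stmt1 (p : ℕ) (hp : 1 ≤ p) (α : ℝ) (hα0 : 0 ≤ α) (hαp : α < p)
    (θ : ℝ) (hθ : θ ≠ 0) :
    (∫ x : ℝ, (fracDerivRight α (cardinalBSpline p) x : ℂ)
        * Complex.exp (-(Complex.I * (θ : ℂ) * (x : ℂ))))
      = negIThetaPow θ α
          * ((1 - Complex.exp (-(Complex.I * (θ : ℂ)))) / (Complex.I * (θ : ℂ))) ^ (p + 1) := by
  have h := K_fourier p α hα0 hαp θ hθ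
  rw [← integral_neg_eq_self] at h
  have e : ∀ x : ℝ, (fracDerivRight α (cardinalBSpline p) x : ℂ)
        * Complex.exp (-(Complex.I * (θ : ℂ) * (x : ℂ))) =
      (((fwdDiff 1)^[p + 1] (tpow (p - α)) (-x) : ℝ) : ℂ) *
        Complex.exp (-(-(Complex.I * θ) * ((-x : ℝ) : ℂ))) := by
    intro x
    rw [fracDeriv_eq p α hαp]
    congr 2
    push_cast; ring
  simp_rw [e]
  rw [h, cpow_ident p α θ hθ]
  have e2 : (1 - Complex.exp (-(Complex.I * (θ : ℂ)))) / (Complex.I * (θ : ℂ))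
      = (Complex.exp (-(Complex.I * θ)) - 1) * (1 / (-(Complex.I * θ))) := by
    rw [one_div, inv_neg]; ring
  rw [e2, mul_pow]
  ring
end

section
/- Let p₁, p₂ ≥ 1 be integers and let α₁, α₂ be real numbers with 0 ≤ α₁ < p₁ and 0 ≤ α₂ < p₂. Then for every k ∈ ℝ, ∫_ℝ (D₋^{α₁} φ_{p₁})(x) · (D₊^{α₂} φ_{p₂})(x+k) dx = (D₋^{α₁+α₂} φ_{p₁+p₂+1})(p₂+1-k). -/
open MeasureTheory

/-- truncated power -/
noncomputable def tP (a x : ℝ) : ℝ := if 0 ≤ x then x ^ a / Real.Gamma (a + 1) else 0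

/-- iterated backward differences of truncated powers -/
noncomputable def tB : ℕ → ℝ → ℝ → ℝ
  | 0, a, x => tP a x
  | (n + 1), a, x => tB n a x - tB n a (x - 1)

lemma tP_mul (a x : ℝ) (ha : 0 ≤ a) : x * tP a x = (a + 1) * tP (a + 1) x := by
  unfold tP
  split_ifs with h
  · have : Real.Gamma (a + 1) ≠ 0 := (Real.Gamma_pos_of_pos (by linarith)).ne'
    rw [Real.Gamma_add_one (by linarith : a + 1 ≠ 0), Real.rpow_add_one' h (by linarith)]
    field_simp
  · simp

lemma tB_mul0 (a x : ℝ) (ha : 0 ≤ a) : x * tB 0 a x = (a + 1) * tB 0 (a + 1) x :=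
  tP_mul a x ha

lemma tB_mul (n : ℕ) (a : ℝ) (ha : 0 ≤ a) : ∀ x : ℝ,
    x * tB (n + 1) a x = (a + 1) * tB (n + 1) (a + 1) x - (n + 1) * tB n a (x - 1) := by
  induction n with
  | zero =>
    intro x
    have h1 := tB_mul0 a x ha
    have h2 := tB_mul0 a (x - 1) ha
    simp only [tB, Nat.cast_zero] at *
    linarith
  | succ n ih =>
    intro x
    have h1 := ih x
    have h2 := ih (x - 1)
    rw [show tB (n + 1 + 1) a x = tB (n + 1) a x - tB (n + 1) a (x - 1) from rfl,
      show tB (n + 1 + 1) (a + 1) x = tB (n + 1) (a + 1) x - tB (n + 1) (a + 1) (x - 1) from rfl]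
    have h3 : tB (n + 1) a (x - 1) = tB n a (x - 1) - tB n a (x - 1 - 1) := rfl
    push_cast
    linear_combination h1 - h2 + ((n : ℝ) + 1) * h3

lemma spline_eq (p : ℕ) : ∀ t, cardinalBSpline p t = tB (p + 1) p t := by
  induction p with
  | zero =>
    intro t
    simp only [cardinalBSpline, tB, tP, Nat.cast_zero, Real.rpow_zero, zero_add, Real.Gamma_one]
    split_ifs <;> grind
  | succ p ih =>
    intro t
    simp only [cardinalBSpline, ih]
    have hp : (p : ℝ) + 1 ≠ 0 := by positivity
    have h1 := tB_mul p p (by positivity) t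
    have h2 := tB_mul p p (by positivity) (t - 1)
    rw [show tB (p + 1 + 1) ((p + 1 : ℕ) : ℝ) t
      = tB (p + 1) ((p + 1 : ℕ) : ℝ) t - tB (p + 1) ((p + 1 : ℕ) : ℝ) (t - 1) from rfl]
    have h3 : tB (p + 1) p (t - 1) = tB p p (t - 1) - tB p p (t - 1 - 1) := rfl
    push_cast
    field_simp
    linear_combination h1 - h2 + ((p : ℝ) + 1) * h3

lemma spline_symm (p : ℕ) : ∀ t, cardinalBSpline (p + 1) ((p : ℝ) + 2 - t)
    = cardinalBSpline (p + 1) t := by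
  induction p with
  | zero =>
    intro t
    simp only [cardinalBSpline, Nat.cast_zero]
    split_ifs <;> grind
  | succ p ih =>
    intro t
    have h1 := ih t
    have h2 := ih (t - 1)
    rw [cardinalBSpline]
    beta_reduce
    rw [show ((p + 1 : ℕ) : ℝ) + 2 - t - 1 = p + 2 - t by push_cast; ring, h1,
      show ((p + 1 : ℕ) : ℝ) + 2 - t = p + 2 - (t - 1) by push_cast; ring, h2]
    push_cast
    ring

lemma tP_conv (a b : ℝ) (ha : -1 < a) (hb : -1 < b) (hab : 0 < a + b + 1) (z : ℝ) :
    Integrable (fun x => tP a x * tP b (z - x)) ∧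
      ∫ x, tP a x * tP b (z - x) = tP (a + b + 1) z := by
  rcases le_or_gt z 0 with hz | hz
  · have h0 : (fun x => tP a x * tP b (z - x)) =ᵐ[volume] fun _ => (0 : ℝ) := by
      have : ∀ᵐ x : ℝ, x ≠ 0 := by simp [ae_iff, measure_singleton]
      filter_upwards [this] with x hx
      unfold tP
      split_ifs with h1 h2 <;> first | simp | skip
      exact absurd (le_antisymm (by linarith) h1) hx
    refine ⟨(integrable_zero _ _ _).congr h0.symm, ?_⟩
    rw [integral_congr_ae h0]
    unfold tP
    split_ifs with h
    · rw [le_antisymm hz h, Real.zero_rpow hab.ne']; simp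
    · simp
  · have key : ∫ x, tP a x * tP b (z - x) = tP (a + b + 1) z := by
      have e1 : (fun x => tP a x * tP b (z - x)) = (Set.Icc 0 z).indicator
          (fun x => (x ^ a * (z - x) ^ b) * (1 / (Real.Gamma (a + 1) * Real.Gamma (b + 1)))) := by
        ext x
        simp only [Set.indicator, tP, Set.mem_Icc]
        split_ifs <;> grind
      rw [e1, integral_indicator measurableSet_Icc, integral_Icc_eq_integral_Ioc,
        ← intervalIntegral.integral_of_le hz.le, intervalIntegral.integral_mul_const]
      have e2 := Complex.betaIntegral_scaled ((a + 1 : ℝ) : ℂ) ((b + 1 : ℝ) : ℂ) hz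
      rw [Complex.betaIntegral_eq_Gamma_mul_div _ _ (by simp; linarith) (by simp; linarith)] at e2
      have e3 : ∫ x in (0:ℝ)..z, (x : ℂ) ^ (((a + 1 : ℝ) : ℂ) - 1)
          * ((z : ℂ) - x) ^ (((b + 1 : ℝ) : ℂ) - 1)
          = ((∫ x in (0:ℝ)..z, x ^ a * (z - x) ^ b : ℝ) : ℂ) := by
        rw [← intervalIntegral.integral_ofReal]
        apply intervalIntegral.integral_congr
        intro x hx
        rw [Set.uIcc_of_le hz.le] at hx
        simp only
        rw [Complex.ofReal_mul, Complex.ofReal_cpow hx.1, Complex.ofReal_cpow (by linarith [hx.2])]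
        push_cast
        simp
      rw [e3, ← Complex.ofReal_add, Complex.Gamma_ofReal, Complex.Gamma_ofReal,
        Complex.Gamma_ofReal, ← Complex.ofReal_one, ← Complex.ofReal_sub,
        ← Complex.ofReal_cpow hz.le, ← Complex.ofReal_mul, ← Complex.ofReal_div,
        ← Complex.ofReal_mul] at e2
      rw [Complex.ofReal_inj.1 e2, tP, if_pos hz.le]
      have g1 : Real.Gamma (a + 1) ≠ 0 := (Real.Gamma_pos_of_pos (by linarith)).ne'
      have g2 : Real.Gamma (b + 1) ≠ 0 := (Real.Gamma_pos_of_pos (by linarith)).ne'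
      rw [show a + 1 + (b + 1) - 1 = a + b + 1 by ring,
        show a + 1 + (b + 1) = a + b + 1 + 1 by ring]
      field_simp
    refine ⟨?_, key⟩
    apply Integrable.of_integral_ne_zero
    rw [key, tP, if_pos hz.le]
    have := Real.Gamma_pos_of_pos (show 0 < a + b + 1 + 1 by linarith)
    positivity

lemma tB_conv0 (m : ℕ) (a b : ℝ) (ha : -1 < a) (hb : -1 < b) (hab : 0 < a + b + 1) :
    ∀ z : ℝ, Integrable (fun x => tP a x * tB m b (z - x)) ∧
      ∫ x, tP a x * tB m b (z - x) = tB m (a + b + 1) z := by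
  induction m with
  | zero => exact fun z => tP_conv a b ha hb hab z
  | succ m ih =>
    intro z
    have e : (fun x => tP a x * tB (m + 1) b (z - x)) = fun x => tP a x * tB m b (z - x)
        - tP a x * tB m b (z - 1 - x) := by
      ext x
      simp only [tB]
      rw [show z - x - 1 = z - 1 - x by ring]; ring
    rw [e]
    refine ⟨(ih z).1.sub (ih (z - 1)).1, ?_⟩
    rw [integral_sub (ih z).1 (ih (z - 1)).1, (ih z).2, (ih (z - 1)).2]
    rfl

lemma tB_conv (n m : ℕ) (a b : ℝ) (ha : -1 < a) (hb : -1 < b) (hab : 0 < a + b + 1) :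
    ∀ z : ℝ, Integrable (fun x => tB n a x * tB m b (z - x)) ∧
      ∫ x, tB n a x * tB m b (z - x) = tB (n + m) (a + b + 1) z := by
  induction n with
  | zero => intro z; rw [Nat.zero_add]; exact tB_conv0 m a b ha hb hab z
  | succ n ih =>
    intro z
    have e : (fun x => tB (n + 1) a x * tB m b (z - x)) = fun x => tB n a x * tB m b (z - x)
        - (fun x => tB n a x * tB m b (z - 1 - x)) (x - 1) := by
      ext x
      simp only [tB]
      rw [show z - 1 - (x - 1) = z - x by ring]; ring
    rw [e]
    have h2 := (ih (z - 1)).1.comp_sub_right 1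
    refine ⟨(ih z).1.sub h2, ?_⟩
    rw [integral_sub (ih z).1 h2, (ih z).2,
      integral_sub_right_eq_self (fun x => tB n a x * tB m b (z - 1 - x)) 1,
      (ih (z - 1)).2, show n + 1 + m = (n + m) + 1 by omega]
    rfl

lemma tP_cont (c : ℝ) (hc : 0 < c) : Continuous (tP c) := by
  have : tP c = fun x => (max x 0) ^ c / Real.Gamma (c + 1) := by
    ext x
    unfold tP
    split_ifs with h
    · rw [max_eq_left h]
    · rw [max_eq_right (by linarith), Real.zero_rpow hc.ne', zero_div]
  rw [this]
  exact ((continuous_id.max continuous_const).rpow_const (fun _ => Or.inr hc.le)).div_const _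

lemma tP_deriv (c : ℝ) (hc : 0 < c) (x : ℝ) : HasDerivAt (tP (c + 1)) (tP c x) x := by
  apply hasDerivAt_of_hasDerivAt_of_ne' (x := 0) _ (tP_cont _ (by linarith)).continuousAt
    (tP_cont _ hc).continuousAt
  intro y hy
  rcases lt_or_gt_of_ne hy with h | h
  · have : tP (c + 1) =ᶠ[nhds y] fun _ => (0 : ℝ) := by
      filter_upwards [Iio_mem_nhds h] with w hw
      exact if_neg (not_le.2 hw)
    rw [show tP c y = 0 from if_neg (not_le.2 h)]
    exact (hasDerivAt_const y (0 : ℝ)).congr_of_eventuallyEq this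
  · have : tP (c + 1) =ᶠ[nhds y] fun w => w ^ (c + 1) / Real.Gamma (c + 1 + 1) := by
      filter_upwards [Ioi_mem_nhds h] with w hw
      exact if_pos (le_of_lt hw)
    refine HasDerivAt.congr_of_eventuallyEq ?_ this
    have h1 := (Real.hasDerivAt_rpow_const (x := y) (p := c + 1) (Or.inl hy)).div_const
      (Real.Gamma (c + 1 + 1))
    refine h1.congr_deriv (Eq.symm ?_)
    have g : Real.Gamma (c + 1) ≠ 0 := (Real.Gamma_pos_of_pos (by linarith)).ne'
    rw [show tP c y = y ^ c / Real.Gamma (c + 1) from if_pos h.le,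
      Real.Gamma_add_one (by linarith : c + 1 ≠ 0), add_sub_cancel_right]
    field_simp

lemma tB_deriv (n : ℕ) (c : ℝ) (hc : 0 < c) : ∀ x, HasDerivAt (tB n (c + 1)) (tB n c x) x := by
  induction n with
  | zero => exact fun x => tP_deriv c hc x
  | succ n ih =>
    intro x
    exact (ih x).sub ((ih (x - 1)).comp_sub_const x 1)

lemma tB_iter (n : ℕ) (c : ℝ) (hc : 0 < c) (e w : ℝ) (m : ℕ) : ∀ K : ℝ,
    iteratedDeriv m (fun z => K * tB n (c + m) (e * z + w))
      = fun z => K * e ^ m * tB n c (e * z + w) := by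
  induction m with
  | zero => intro K; simp
  | succ m ih =>
    intro K
    rw [iteratedDeriv_succ']
    have : deriv (fun z => K * tB n (c + (m + 1 : ℕ)) (e * z + w))
        = fun z => (K * e) * tB n (c + m) (e * z + w) := by
      ext z
      have h0 : HasDerivAt (fun z => e * z + w) e z := by
        simpa using ((hasDerivAt_id z).const_mul e).add_const w
      have h1 := ((tB_deriv n (c + m) (by positivity) (e * z + w)).comp z h0).const_mul K
      rw [show c + ((m + 1 : ℕ) : ℝ) = c + m + 1 by push_cast; ring]
      refine Eq.trans h1.deriv ?_
      ring
    rw [this, ih]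
    ext z
    ring

lemma left_int (p : ℕ) (hp : 1 ≤ p) (s : ℝ) (hs : -1 < s) (z : ℝ) :
    ∫ y in Set.Iic z, (z - y) ^ s * cardinalBSpline p y
      = Real.Gamma (s + 1) * tB (p + 1) (p + s + 1) z := by
  have hp' : (1 : ℝ) ≤ p := by exact_mod_cast hp
  have h := (tB_conv (p + 1) 0 p s (by linarith) hs (by linarith) z).2
  rw [Nat.add_zero] at h
  rw [← h, ← integral_const_mul, ← integral_indicator measurableSet_Iic]
  congr 1
  ext y
  have g : Real.Gamma (s + 1) ≠ 0 := (Real.Gamma_pos_of_pos (by linarith)).ne'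
  simp only [Set.indicator, Set.mem_Iic, spline_eq, show ∀ x, tB 0 s x = tP s x from fun _ => rfl]
  unfold tP
  by_cases hy : y ≤ z
  · rw [if_pos hy, if_pos (by linarith)]; field_simp
  · rw [if_neg hy, if_neg (by linarith)]; simp

lemma right_int (p : ℕ) (hp : 1 ≤ p) (s : ℝ) (hs : -1 < s) (z : ℝ) :
    ∫ y in Set.Ici z, (y - z) ^ s * cardinalBSpline p y
      = Real.Gamma (s + 1) * tB (p + 1) (p + s + 1) (p + 1 - z) := by
  rw [← left_int p hp s hs, ← integral_indicator measurableSet_Iic,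
    ← integral_indicator measurableSet_Ici,
    ← integral_sub_left_eq_self _ volume ((p : ℝ) + 1)]
  congr 1
  ext y
  obtain ⟨q, rfl⟩ := Nat.exists_eq_add_of_le' hp
  have := spline_symm q y
  rw [show (q : ℝ) + 2 - y = ((q + 1 : ℕ) : ℝ) + 1 - y by push_cast; ring] at this
  simp only [Set.indicator, Set.mem_Iic, Set.mem_Ici, this]
  by_cases hy : z ≤ ((q + 1 : ℕ) : ℝ) + 1 - y
  · rw [if_pos hy, if_pos (by linarith)]; ring_nf
  · rw [if_neg hy, if_neg (fun h => hy (by linarith))]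

lemma left_eq (p : ℕ) (hp : 1 ≤ p) (α : ℝ) (h0 : 0 ≤ α) (h1 : α < p) (x : ℝ) :
    fracDerivLeft α (cardinalBSpline p) x = tB (p + 1) (p - α) x := by
  unfold fracDerivLeft
  have hf := Nat.lt_floor_add_one α
  simp only [left_int p hp _ (show -1 < (⌊α⌋₊ : ℝ) + 1 - α - 1 by linarith)]
  have h := congrFun (tB_iter (p + 1) (p - α) (by linarith) 1 0 (⌊α⌋₊ + 1)
    (Real.Gamma ((⌊α⌋₊ : ℝ) + 1 - α))) x
  have g : Real.Gamma ((⌊α⌋₊ : ℝ) + 1 - α) ≠ 0 := (Real.Gamma_pos_of_pos (by linarith)).ne'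
  simp only [one_mul, add_zero, one_pow, mul_one] at h
  rw [sub_add_cancel, show (p : ℝ) + ((⌊α⌋₊ : ℝ) + 1 - α - 1) + 1
    = p - α + ((⌊α⌋₊ + 1 : ℕ) : ℝ) by push_cast; ring, h]
  field_simp

lemma right_eq (p : ℕ) (hp : 1 ≤ p) (α : ℝ) (h0 : 0 ≤ α) (h1 : α < p) (x : ℝ) :
    fracDerivRight α (cardinalBSpline p) x = tB (p + 1) (p - α) (p + 1 - x) := by
  unfold fracDerivRight
  have hf := Nat.lt_floor_add_one α
  simp only [right_int p hp _ (show -1 < (⌊α⌋₊ : ℝ) + 1 - α - 1 by linarith)]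
  have h := congrFun (tB_iter (p + 1) (p - α) (by linarith) (-1) (p + 1) (⌊α⌋₊ + 1)
    (Real.Gamma ((⌊α⌋₊ : ℝ) + 1 - α))) x
  have g : Real.Gamma ((⌊α⌋₊ : ℝ) + 1 - α) ≠ 0 := (Real.Gamma_pos_of_pos (by linarith)).ne'
  simp only [show ∀ z : ℝ, -1 * z + ((p : ℝ) + 1) = p + 1 - z from fun z => by ring] at h
  rw [sub_add_cancel, show (p : ℝ) + ((⌊α⌋₊ : ℝ) + 1 - α - 1) + 1
    = p - α + ((⌊α⌋₊ + 1 : ℕ) : ℝ) by push_cast; ring, h]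
  have hs : ((-1 : ℝ) ^ (⌊α⌋₊ + 1)) * (-1) ^ (⌊α⌋₊ + 1) = 1 := by
    rw [← mul_pow]; simp
  field_simp
  linear_combination (tB (p + 1) (p - α) (p + 1 - x)) * hs

theorem stmt3 (p₁ p₂ : ℕ) (hp₁ : 1 ≤ p₁) (hp₂ : 1 ≤ p₂) (α₁ α₂ : ℝ)
    (h₁0 : 0 ≤ α₁) (h₁p : α₁ < p₁) (h₂0 : 0 ≤ α₂) (h₂p : α₂ < p₂) (k : ℝ) :
    (∫ x : ℝ, fracDerivLeft α₁ (cardinalBSpline p₁) x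
        * fracDerivRight α₂ (cardinalBSpline p₂) (x + k))
      = fracDerivLeft (α₁ + α₂) (cardinalBSpline (p₁ + p₂ + 1)) ((p₂ : ℝ) + 1 - k) := by
  
  have hA : ∀ x, fracDerivLeft α₁ (cardinalBSpline p₁) x = tB (p₁ + 1) (p₁ - α₁) x :=
    fun x => left_eq p₁ hp₁ α₁ h₁0 h₁p x
  have hB : ∀ x, fracDerivRight α₂ (cardinalBSpline p₂) x
      = tB (p₂ + 1) (p₂ - α₂) (p₂ + 1 - x) := fun x => right_eq p₂ hp₂ α₂ h₂0 h₂p x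
  have hC := left_eq (p₁ + p₂ + 1) (by omega) (α₁ + α₂) (by linarith)
    (by push_cast; linarith) ((p₂ : ℝ) + 1 - k)
  rw [hC]
  simp only [hA, hB]
  have := (tB_conv (p₁ + 1) (p₂ + 1) (p₁ - α₁) (p₂ - α₂) (by linarith) (by linarith)
    (by linarith) ((p₂ : ℝ) + 1 - k)).2
  rw [show p₁ + p₂ + 1 + 1 = (p₁ + 1) + (p₂ + 1) by omega,
    show ((p₁ + p₂ + 1 : ℕ) : ℝ) - (α₁ + α₂) = (p₁ - α₁) + (p₂ - α₂) + 1 by push_cast; ring,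
    ← this]
  congr 1; ext x; congr 2; ring
end

section
/- Let p₁, p₂ ≥ 1 be integers and let α₁, α₂ be real numbers with 0 ≤ α₁ < p₁ and 0 ≤ α₂ < p₂. Then for every k ∈ ℝ, ∫_ℝ (D₊^{α₁} φ_{p₁})(x) · (D₋^{α₂} φ_{p₂})(x+k) dx = (D₊^{α₁+α₂} φ_{p₁+p₂+1})(p₂+1-k). -/
open MeasureTheory

noncomputable def bsP (s x : ℝ) : ℝ := if 0 < x then x ^ s / Real.Gamma (s + 1) else 0

def bsD : ℕ → (ℝ → ℝ) → ℝ → ℝ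
  | 0, g => g
  | (n + 1), g => fun t => bsD n g t - bsD n g (t - 1)

lemma bsD_add (m n : ℕ) (g : ℝ → ℝ) : bsD m (bsD n g) = bsD (m + n) g := by
  induction m with
  | zero => simp [bsD]
  | succ k ih => rw [Nat.add_right_comm]; funext t; simp only [bsD]; rw [ih]

lemma bsD_smul (n : ℕ) (g : ℝ → ℝ) (c : ℝ) (t : ℝ) :
    bsD n (fun x => c * g x) t = c * bsD n g t := by
  induction n generalizing t with
  | zero => simp [bsD]
  | succ k ih => simp only [bsD, ih]; ring

lemma bsD_mulX (n : ℕ) (g : ℝ → ℝ) (t : ℝ) :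
    bsD (n + 1) (fun x => x * g x) t = t * bsD n g t + ((n : ℝ) + 1 - t) * bsD n g (t - 1) := by
  induction n generalizing t with
  | zero => simp [bsD]; ring
  | succ k ih =>
    change bsD (k + 1) _ t - bsD (k + 1) _ (t - 1) = _
    rw [ih, ih]
    simp only [bsD]
    push_cast
    ring

lemma bsD_hasDeriv (n : ℕ) (g g' : ℝ → ℝ) (h : ∀ x, HasDerivAt g (g' x) x) (x : ℝ) :
    HasDerivAt (bsD n g) (bsD n g' x) x := by
  induction n generalizing x with
  | zero => exact h x
  | succ k ih =>
    simp only [bsD]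
    exact (ih x).sub ((ih (x - 1)).comp_sub_const x 1)

lemma bsD_cont (n : ℕ) (g : ℝ → ℝ) (h : Continuous g) : Continuous (bsD n g) := by
  induction n with
  | zero => exact h
  | succ k ih => exact ih.sub (ih.comp (continuous_id.sub continuous_const))

lemma bsD_zero (n : ℕ) (g : ℝ → ℝ) (h : ∀ x ≤ 0, g x = 0) : ∀ x ≤ 0, bsD n g x = 0 := by
  induction n with
  | zero => exact h
  | succ k ih =>
    intro x hx
    simp only [bsD]
    rw [ih x hx, ih (x - 1) (by linarith), sub_zero]

/-- explicit form with natural powers -/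
lemma bspline_formula (p : ℕ) (t : ℝ) : cardinalBSpline p t =
    bsD (p + 1) (fun x => if 0 ≤ x then x ^ p / (p.factorial : ℝ) else 0) t := by
  induction p generalizing t with
  | zero =>
    simp only [cardinalBSpline, bsD]
    by_cases h1 : 0 ≤ t <;> by_cases h2 : t < 1
    · have : ¬ (0 ≤ t - 1) := by linarith
      have h3 : ¬ 1 ≤ t := by linarith
      simp [h1, h2, h3]
    · have : (0 ≤ t - 1) := by linarith
      have h3 : 1 ≤ t := by linarith
      simp [h1, h2, h3]
    · have : ¬ (0 ≤ t - 1) := by linarith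
      have h3 : ¬ 1 ≤ t := by linarith
      simp [h1, h3]
    · exfalso; linarith
  | succ p ih =>
    have e : (fun x : ℝ => if 0 ≤ x then x ^ (p + 1) / ((p + 1).factorial : ℝ) else 0)
        = fun x => (1 / ((p : ℝ) + 1)) * ((fun x : ℝ => x * (fun x : ℝ =>
          if 0 ≤ x then x ^ p / (p.factorial : ℝ) else 0) x) x) := by
      funext x
      by_cases hx : 0 ≤ x
      · simp only [hx, if_true, Nat.factorial_succ]
        have : (p.factorial : ℝ) ≠ 0 := by positivity
        have : (p : ℝ) + 1 ≠ 0 := by positivity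
        push_cast
        field_simp
        ring
      · simp [hx]
    rw [e, bsD_smul, bsD_mulX]
    simp only [cardinalBSpline]
    rw [ih, ih]
    push_cast
    ring

lemma bspline_eq_s4 (p : ℕ) (hp : 1 ≤ p) : cardinalBSpline p = bsD (p + 1) (bsP p) := by
  funext t
  rw [bspline_formula]
  congr 1
  funext x
  unfold bsP
  rw [Real.Gamma_nat_eq_factorial]
  rcases lt_trichotomy x 0 with h | h | h
  · rw [if_neg (by linarith), if_neg (by linarith)]
  · subst h
    have : p ≠ 0 := by omega
    simp [this]
  · rw [if_pos h.le, if_pos h, Real.rpow_natCast]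

lemma bspline_symm (p : ℕ) (hp : 1 ≤ p) (t : ℝ) :
    cardinalBSpline p ((p : ℝ) + 1 - t) = cardinalBSpline p t := by
  induction p, hp using Nat.le_induction generalizing t with
  | base =>
    simp only [cardinalBSpline]
    push_cast
    rcases lt_trichotomy t 0 with h | h | h
    · repeat rw [if_neg (by intro h'; linarith [h'.1, h'.2])]
      simp
    · subst h; norm_num
    rcases lt_trichotomy t 1 with h1 | h1 | h1
    · rw [if_neg (by intro h'; linarith [h'.1, h'.2]), if_pos (by constructor <;> linarith),
        if_pos (by constructor <;> linarith), if_neg (by intro h'; linarith [h'.1, h'.2])]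
      ring
    · subst h1; norm_num
    rcases lt_trichotomy t 2 with h2 | h2 | h2
    · rw [if_pos (by constructor <;> linarith), if_neg (by intro h'; linarith [h'.1, h'.2]),
        if_neg (by intro h'; linarith [h'.1, h'.2]), if_pos (by constructor <;> linarith)]
      ring
    · subst h2; norm_num
    · repeat rw [if_neg (by intro h'; linarith [h'.1, h'.2])]
      simp
  | succ p hp ih =>
    simp only [cardinalBSpline]
    have e1 : (((p + 1 : ℕ) : ℝ) + 1 - t) = (p : ℝ) + 1 - (t - 1) := by push_cast; ring
    have e2 : (p : ℝ) + 1 - (t - 1) - 1 = (p : ℝ) + 1 - t := by ring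
    rw [e1, e2, ih, ih]
    ring

lemma bsP_zero (s : ℝ) : ∀ x ≤ 0, bsP s x = 0 := fun x hx => by
  unfold bsP; rw [if_neg (by linarith)]

lemma bsP_cont (s : ℝ) (hs : 0 < s) : Continuous (bsP s) := by
  have : bsP s = fun x => (max x 0) ^ s / Real.Gamma (s + 1) := by
    funext x
    unfold bsP
    split_ifs with h
    · rw [max_eq_left h.le]
    · rw [max_eq_right (by linarith), Real.zero_rpow hs.ne', zero_div]
  rw [this]
  exact ((continuous_id.max continuous_const).rpow_const (fun _ => Or.inr hs.le)).div_const _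

lemma bsP_deriv (s : ℝ) (hs : 0 < s) (x : ℝ) : HasDerivAt (bsP (s + 1)) (bsP s x) x := by
  have key : ∀ y ≠ (0 : ℝ), HasDerivAt (bsP (s + 1)) (bsP s y) y := by
    intro y hy
    rcases lt_or_gt_of_ne hy with h | h
    · rw [bsP_zero s y h.le]
      refine (hasDerivAt_const y (0 : ℝ)).congr_of_eventuallyEq ?_
      filter_upwards [Iio_mem_nhds h] with z hz
      exact bsP_zero _ z (le_of_lt hz)
    · have h1 := (Real.hasDerivAt_rpow_const (x := y) (p := s + 1) (Or.inl hy)).div_const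
        (Real.Gamma (s + 1 + 1))
      have e : bsP s y = (s + 1) * y ^ (s + 1 - 1) / Real.Gamma (s + 1 + 1) := by
        unfold bsP
        rw [if_pos h, Real.Gamma_add_one (s := s + 1) (by positivity), add_sub_cancel_right]
        have := (Real.Gamma_pos_of_pos (show 0 < s + 1 by positivity)).ne'
        field_simp
      rw [e]
      refine h1.congr_of_eventuallyEq ?_
      filter_upwards [Ioi_mem_nhds h] with z hz
      unfold bsP
      rw [if_pos (show 0 < z from hz)]
  by_cases hx : x = 0
  · subst hx
    exact hasDerivAt_of_hasDerivAt_of_ne key (bsP_cont _ (by positivity)).continuousAt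
      (bsP_cont _ hs).continuousAt
  · exact key x hx

lemma bsD_iter (n m : ℕ) (s : ℝ) (hs : 0 < s) :
    iteratedDeriv m (bsD n (bsP (s + m))) = bsD n (bsP s) := by
  induction m with
  | zero => simp
  | succ k ih =>
    rw [iteratedDeriv_succ', ← ih]
    congr 1
    funext x
    have : s + ((k + 1 : ℕ) : ℝ) = (s + k) + 1 := by push_cast; ring
    rw [this]
    exact (bsD_hasDeriv n _ _ (bsP_deriv (s + k) (by positivity)) x).deriv

lemma bsP_intInt (s : ℝ) (hs : -1 < s) (a b : ℝ) : IntervalIntegrable (bsP s) volume a b := by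
  have h := ((intervalIntegral.intervalIntegrable_rpow' hs (a := a) (b := b)).div_const
    (Real.Gamma (s + 1)))
  rw [intervalIntegrable_iff] at h ⊢
  have e : bsP s = (Set.Ioi (0 : ℝ)).indicator (fun x => x ^ s / Real.Gamma (s + 1)) := by
    funext x
    simp [bsP, Set.indicator]
  rw [e]
  exact h.indicator measurableSet_Ioi

noncomputable def bsConv (f g : ℝ → ℝ) (c : ℝ) : ℝ := ∫ y, f (c - y) * g y

lemma bsConv_int (f g : ℝ → ℝ) (hf : ∀ a b, IntervalIntegrable f volume a b)
    (hf0 : ∀ x ≤ 0, f x = 0) (hg : Continuous g) (hg0 : ∀ x ≤ 0, g x = 0) (c : ℝ) :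
    Integrable (fun y => f (c - y) * g y) := by
  have h1 : IntervalIntegrable (fun y => f (c - y) * g y) volume 0 (max c 0) := by
    have := (hf c (c - max c 0)).comp_sub_left c
    simp only [sub_self, sub_sub_cancel] at this
    exact this.mul_continuousOn hg.continuousOn
  rw [intervalIntegrable_iff, Set.uIoc_of_le (le_max_right _ _)] at h1
  refine (integrableOn_iff_integrable_of_support_subset ?_).1 h1
  intro y hy
  by_contra hcon
  apply hy
  by_cases h0 : y ≤ 0
  · simp [hg0 y h0]
  · have : ¬ y ≤ max c 0 := fun h => hcon ⟨by linarith, h⟩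
    have : c < y := lt_of_le_of_lt (le_max_left c 0) (not_le.1 this)
    simp [hf0 (c - y) (by linarith)]

lemma bsD_intInt (n : ℕ) (f : ℝ → ℝ) (hf : ∀ a b, IntervalIntegrable f volume a b) :
    ∀ a b, IntervalIntegrable (bsD n f) volume a b := by
  induction n with
  | zero => exact hf
  | succ k ih =>
    intro a b
    have := (ih (a - 1) (b - 1)).comp_sub_right 1
    simp only [sub_add_cancel] at this
    exact (ih a b).sub this

lemma bsConv_D_right (n : ℕ) (f g : ℝ → ℝ) (hf : ∀ a b, IntervalIntegrable f volume a b)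
    (hf0 : ∀ x ≤ 0, f x = 0) (hg : Continuous g) (hg0 : ∀ x ≤ 0, g x = 0) (c : ℝ) :
    bsConv f (bsD n g) c = bsD n (bsConv f g) c := by
  induction n generalizing c with
  | zero => rfl
  | succ k ih =>
    simp only [bsD]
    rw [← ih, ← ih]
    have hI := fun c => bsConv_int f (bsD k g) hf hf0 (bsD_cont k g hg) (bsD_zero k g hg0) c
    have e : (fun y => f (c - y) * bsD k g (y - 1))
        = fun y => (fun z => f (c - 1 - z) * bsD k g z) (y - 1) := by
      funext y
      simp only
      congr 2
      ring
    have hI2 : Integrable (fun y => f (c - y) * bsD k g (y - 1)) := by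
      rw [e]; exact (hI (c - 1)).comp_sub_right 1
    have e2 : ∫ y, f (c - y) * bsD k g (y - 1) = bsConv f (bsD k g) (c - 1) := by
      rw [e, integral_sub_right_eq_self (fun z => f (c - 1 - z) * bsD k g z)]; rfl
    rw [← e2]
    unfold bsConv
    rw [← integral_sub (hI c) hI2]
    congr 1
    funext y
    ring

lemma bsConv_D_left (n : ℕ) (f g : ℝ → ℝ) (hf : ∀ a b, IntervalIntegrable f volume a b)
    (hf0 : ∀ x ≤ 0, f x = 0) (hg : Continuous g) (hg0 : ∀ x ≤ 0, g x = 0) (c : ℝ) :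
    bsConv (bsD n f) g c = bsD n (bsConv f g) c := by
  induction n generalizing c with
  | zero => rfl
  | succ k ih =>
    simp only [bsD]
    rw [← ih, ← ih]
    have hI := fun c => bsConv_int (bsD k f) g (bsD_intInt k f hf) (bsD_zero k f hf0) hg hg0 c
    unfold bsConv
    rw [← integral_sub (hI c) (hI (c - 1))]
    congr 1
    funext y
    rw [show c - 1 - y = c - y - 1 by ring]
    ring

lemma real_beta_scaled (a b c : ℝ) (ha : -1 < a) (hb : -1 < b) (hc : 0 < c) :
    ∫ x in (0 : ℝ)..c, x ^ b * (c - x) ^ a =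
      c ^ (a + b + 1) * (Real.Gamma (a + 1) * Real.Gamma (b + 1) / Real.Gamma (a + b + 2)) := by
  have h := Complex.betaIntegral_scaled ((b : ℂ) + 1) ((a : ℂ) + 1) hc
  have hB := Complex.Gamma_mul_Gamma_eq_betaIntegral (s := (b : ℂ) + 1) (t := (a : ℂ) + 1)
    (by simp; linarith) (by simp; linarith)
  have hG : Real.Gamma (a + b + 2) ≠ 0 := (Real.Gamma_pos_of_pos (by linarith)).ne'
  have e1 : ((b : ℂ) + 1) = ((b + 1 : ℝ) : ℂ) := by push_cast; ring
  have e2 : ((a : ℂ) + 1) = ((a + 1 : ℝ) : ℂ) := by push_cast; ring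
  have e3 : ((b : ℂ) + 1) + ((a : ℂ) + 1) = ((a + b + 2 : ℝ) : ℂ) := by push_cast; ring
  rw [e3] at hB
  have hB' : Complex.betaIntegral ((b : ℂ) + 1) ((a : ℂ) + 1) =
      ((Real.Gamma (a + 1) * Real.Gamma (b + 1) / Real.Gamma (a + b + 2) : ℝ) : ℂ) := by
    rw [Complex.Gamma_ofReal] at hB
    have hG' : ((Real.Gamma (a + b + 2) : ℝ) : ℂ) ≠ 0 := by exact_mod_cast hG
    push_cast
    rw [eq_div_iff hG', mul_comm, ← hB, e1, e2, Complex.Gamma_ofReal, Complex.Gamma_ofReal,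
      mul_comm]
  rw [hB'] at h
  have e4 : ((b : ℂ) + 1) + ((a : ℂ) + 1) - 1 = ((a + b + 1 : ℝ) : ℂ) := by push_cast; ring
  rw [e4, ← Complex.ofReal_cpow hc.le, ← Complex.ofReal_mul] at h
  apply Complex.ofReal_injective
  rw [← h, ← intervalIntegral.integral_ofReal]
  apply intervalIntegral.integral_congr
  intro x hx
  rw [Set.uIcc_of_le hc.le] at hx
  simp only [add_sub_cancel_right]
  rw [Complex.ofReal_mul, Complex.ofReal_cpow hx.1, Complex.ofReal_cpow (by linarith [hx.2])]
  push_cast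
  rfl

lemma bsConv_P (a b : ℝ) (ha : -1 < a) (hb : -1 < b) (c : ℝ) :
    bsConv (bsP a) (bsP b) c = bsP (a + b + 1) c := by
  unfold bsConv
  by_cases hc : 0 < c
  · have h := real_beta_scaled a b c ha hb hc
    rw [intervalIntegral.integral_of_le hc.le, integral_Ioc_eq_integral_Ioo] at h
    have e : (fun y => bsP a (c - y) * bsP b y) = (Set.Ioo 0 c).indicator
        (fun x => (x ^ b * (c - x) ^ a) * (1 / (Real.Gamma (a + 1) * Real.Gamma (b + 1)))) := by
      funext y
      by_cases hy : y ∈ Set.Ioo 0 c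
      · rw [Set.indicator_of_mem hy]
        unfold bsP
        rw [if_pos hy.1, if_pos (by linarith [hy.2])]
        ring
      · rw [Set.indicator_of_notMem hy]
        by_cases h0 : y ≤ 0
        · rw [bsP_zero b y h0, mul_zero]
        · rw [bsP_zero a (c - y), zero_mul]
          by_contra hh
          exact hy ⟨by linarith, by linarith⟩
    rw [e, integral_indicator measurableSet_Ioo, integral_mul_const, h]
    unfold bsP
    rw [if_pos hc, show a + b + 1 + 1 = a + b + 2 by ring]
    have h1 := (Real.Gamma_pos_of_pos (show 0 < a + 1 by linarith)).ne'
    have h2 := (Real.Gamma_pos_of_pos (show 0 < b + 1 by linarith)).ne'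
    field_simp
  · rw [bsP_zero _ c (by linarith)]
    rw [← integral_zero ℝ ℝ]
    congr 1
    funext y
    by_cases h0 : y ≤ 0
    · rw [bsP_zero b y h0, mul_zero]
    · rw [bsP_zero a (c - y) (by linarith), zero_mul]

lemma fracLeft_eq (p : ℕ) (hp : 1 ≤ p) (α : ℝ) (h0 : 0 ≤ α) (h1 : α < p) (x : ℝ) :
    fracDerivLeft α (cardinalBSpline p) x = bsD (p + 1) (bsP (p - α)) x := by
  have hp0 : (0 : ℝ) < p := by exact_mod_cast hp
  have hm := Nat.lt_floor_add_one α
  unfold fracDerivLeft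
  rw [bspline_eq_s4 p hp]
  set e : ℝ := (⌊α⌋₊ : ℝ) + 1 - α - 1 with he
  have he1 : -1 < e := by rw [he]; linarith
  have hG : Real.Gamma (e + 1) ≠ 0 := (Real.Gamma_pos_of_pos (by linarith)).ne'
  have hfun : (fun z => ∫ y in Set.Iic z, (z - y) ^ e * bsD (p + 1) (bsP p) y)
      = fun z => Real.Gamma (e + 1) * bsD (p + 1) (bsP ((p - α) + (⌊α⌋₊ + 1 : ℕ))) z := by
    funext z
    have hc : bsConv (bsP e) (bsP p) = bsP ((p - α) + (⌊α⌋₊ + 1 : ℕ)) := by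
      funext c
      rw [bsConv_P e p he1 (by linarith)]
      congr 1
      rw [he]; push_cast; ring
    rw [← hc, ← bsConv_D_right _ _ _ (bsP_intInt e he1) (bsP_zero e) (bsP_cont _ hp0) (bsP_zero _)]
    unfold bsConv
    rw [← integral_const_mul, integral_Iic_eq_integral_Iio, ← integral_indicator measurableSet_Iio]
    congr 1
    funext y
    by_cases hy : y < z
    · rw [Set.indicator_of_mem (show y ∈ Set.Iio z from hy)]
      rw [show bsP e (z - y) = (z - y) ^ e / Real.Gamma (e + 1) by
        unfold bsP; rw [if_pos (by linarith)]]
      field_simp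
    · rw [Set.indicator_of_notMem (show y ∉ Set.Iio z from hy), bsP_zero e (z - y) (by linarith)]
      ring
  rw [hfun, iteratedDeriv_const_mul_field, bsD_iter _ _ _ (by linarith),
    show (⌊α⌋₊ : ℝ) + 1 - α = e + 1 by rw [he]; ring]
  field_simp

lemma fracRight_eq (p : ℕ) (hp : 1 ≤ p) (α : ℝ) (x : ℝ) :
    fracDerivRight α (cardinalBSpline p) x =
      fracDerivLeft α (cardinalBSpline p) ((p : ℝ) + 1 - x) := by
  unfold fracDerivRight fracDerivLeft
  set e : ℝ := (⌊α⌋₊ : ℝ) + 1 - α - 1 with he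
  have hfun : (fun z => ∫ y in Set.Ici z, (y - z) ^ e * cardinalBSpline p y)
      = fun z => (fun w => ∫ y in Set.Iic w, (w - y) ^ e * cardinalBSpline p y)
        ((p : ℝ) + 1 - z) := by
    funext z
    simp only
    rw [← integral_indicator measurableSet_Ici, ← integral_indicator measurableSet_Iic,
      ← integral_sub_left_eq_self _ _ ((p : ℝ) + 1)]
    congr 1
    funext y
    by_cases hy : y ≤ (p : ℝ) + 1 - z
    · rw [Set.indicator_of_mem (show y ∈ Set.Iic ((p : ℝ) + 1 - z) from hy),
        Set.indicator_of_mem (show (p : ℝ) + 1 - y ∈ Set.Ici z by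
          simp only [Set.mem_Ici]; linarith), bspline_symm p hp]
      congr 2
      ring
    · rw [Set.indicator_of_notMem (show y ∉ Set.Iic ((p : ℝ) + 1 - z) from hy),
        Set.indicator_of_notMem (show (p : ℝ) + 1 - y ∉ Set.Ici z by
          simp only [Set.mem_Ici]; intro h; apply hy; linarith)]
  rw [hfun, iteratedDeriv_comp_const_sub _ (fun w => ∫ y in Set.Iic w, (w - y) ^ e * cardinalBSpline p y)
    ((p : ℝ) + 1)]
  simp only [smul_eq_mul]
  rw [div_mul_eq_mul_div, ← mul_assoc, ← mul_pow]
  simp only [mul_neg, mul_one, neg_neg, one_pow, one_mul]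
  ring

theorem stmt4 (p₁ p₂ : ℕ) (hp₁ : 1 ≤ p₁) (hp₂ : 1 ≤ p₂) (α₁ α₂ : ℝ)
    (h₁0 : 0 ≤ α₁) (h₁p : α₁ < p₁) (h₂0 : 0 ≤ α₂) (h₂p : α₂ < p₂) (k : ℝ) :
    (∫ x : ℝ, fracDerivRight α₁ (cardinalBSpline p₁) x
        * fracDerivLeft α₂ (cardinalBSpline p₂) (x + k))
      = fracDerivRight (α₁ + α₂) (cardinalBSpline (p₁ + p₂ + 1)) ((p₂ : ℝ) + 1 - k) := by
  rw [fracRight_eq _ (by omega), fracLeft_eq _ (by omega) _ (by linarith) (by push_cast; linarith)]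
  have e : (fun x => fracDerivRight α₁ (cardinalBSpline p₁) x
        * fracDerivLeft α₂ (cardinalBSpline p₂) (x + k))
      = fun x => (fun y => bsD (p₁ + 1) (bsP (p₁ - α₁)) ((p₁ : ℝ) + 1 + k - y)
          * bsD (p₂ + 1) (bsP (p₂ - α₂)) y) (x + k) := by
    funext x
    rw [fracRight_eq _ hp₁, fracLeft_eq _ hp₁ _ h₁0 h₁p, fracLeft_eq _ hp₂ _ h₂0 h₂p]
    simp only
    congr 2
    ring
  rw [e, integral_add_right_eq_self (fun y => bsD (p₁ + 1) (bsP (p₁ - α₁)) ((p₁ : ℝ) + 1 + k - y)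
          * bsD (p₂ + 1) (bsP (p₂ - α₂)) y)]
  change bsConv _ _ _ = _
  have hs1 : 0 < (p₁ : ℝ) - α₁ := by linarith
  have hs2 : 0 < (p₂ : ℝ) - α₂ := by linarith
  have hi := bsP_intInt ((p₁ : ℝ) - α₁) (by linarith)
  rw [bsConv_D_right _ _ _ (bsD_intInt _ _ hi) (bsD_zero _ _ (bsP_zero _))
    (bsP_cont _ hs2) (bsP_zero _)]
  have e2 : bsConv (bsD (p₁ + 1) (bsP (p₁ - α₁))) (bsP (p₂ - α₂))
      = bsD (p₁ + 1) (bsP (p₁ - α₁ + (p₂ - α₂) + 1)) := by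
    funext c
    rw [bsConv_D_left _ _ _ hi (bsP_zero _) (bsP_cont _ hs2) (bsP_zero _)]
    congr 1
    funext c
    exact bsConv_P _ _ (by linarith) (by linarith) c
  rw [e2, bsD_add]
  rw [show p₂ + 1 + (p₁ + 1) = p₁ + p₂ + 1 + 1 by ring]
  congr 1
  · congr 1
    push_cast; ring
  · push_cast; ring
end

section
/- Let p ≥ 2 be an integer and let α ∈ (1,2) with p > α. Then there exists a constant C_{p,α} > 0 (depending only on p and α) such that for all θ ∈ [0,π]: θ^α · (sin(θ/2)/(θ/2))^{p+1} ≤ f^{p,α}(θ) ≤ θ^α · (sin(θ/2)/(θ/2))^{p+1} + C_{p,α} · (sin(θ/2))^{p+1}, with the convention that (sin(θ/2)/(θ/2))^{p+1} = 1 at θ = 0. -/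
open MeasureTheory

/-- `sin x / x` with value 1 at 0. -/
noncomputable def sincf (x : ℝ) : ℝ := if x = 0 then 1 else Real.sin x / x

/-- The symbol `f^{p,α}`. -/
noncomputable def fSymbol (p : ℕ) (α : ℝ) (θ : ℝ) : ℝ :=
  ∑' l : ℤ, |θ + 2 * (l : ℝ) * Real.pi| ^ α * sincf (θ / 2 + (l : ℝ) * Real.pi) ^ (p + 1)

lemma aux_convex (s : ℝ) (hs : s ≤ 0) : ConvexOn ℝ (Set.Ioi (0:ℝ)) (fun x : ℝ => x ^ s) := by
  refine ⟨convex_Ioi 0, ?_⟩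
  intro x hx y hy a b ha hb hab
  have hx' : (0:ℝ) < x := hx
  have hy' : (0:ℝ) < y := hy
  have hm : (0:ℝ) < a • x + b • y := (convex_Ioi (0:ℝ)) hx hy ha hb hab
  have hl := strictConcaveOn_log_Ioi.concaveOn.2 hx hy ha hb hab
  have he := convexOn_exp.2 (Set.mem_univ (Real.log x * s)) (Set.mem_univ (Real.log y * s)) ha hb hab
  simp only [smul_eq_mul] at *
  rw [Real.rpow_def_of_pos hx', Real.rpow_def_of_pos hy', Real.rpow_def_of_pos hm]
  refine le_trans (Real.exp_le_exp.2 ?_) he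
  nlinarith

lemma aux_four (s : ℝ) (hs : s ≤ 0) (a b t : ℝ) (ht : 0 ≤ t) (hat : t < a) (hab : a < b) :
    (a + t) ^ s + (b - t) ^ s ≤ (a - t) ^ s + (b + t) ^ s := by
  have hD : 0 < b - a + 2 * t := by linarith
  have hc := aux_convex s hs
  have hx : a - t ∈ Set.Ioi (0:ℝ) := by simp; linarith
  have hy : b + t ∈ Set.Ioi (0:ℝ) := by simp; linarith
  have h0 : 0 ≤ (b - a) / (b - a + 2 * t) := div_nonneg (by linarith) hD.le
  have h1 : 0 ≤ 2 * t / (b - a + 2 * t) := div_nonneg (by linarith) hD.le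
  have hs1 : (b - a) / (b - a + 2 * t) + 2 * t / (b - a + 2 * t) = 1 := by field_simp
  have e1 := hc.2 hx hy h0 h1 hs1
  have e2 := hc.2 hx hy h1 h0 (by linarith)
  simp only [smul_eq_mul] at e1 e2
  have q1 : (b - a) / (b - a + 2 * t) * (a - t) + 2 * t / (b - a + 2 * t) * (b + t) = a + t := by
    field_simp; ring
  have q2 : 2 * t / (b - a + 2 * t) * (a - t) + (b - a) / (b - a + 2 * t) * (b + t) = b - t := by
    field_simp; ring
  rw [q1] at e1
  rw [q2] at e2
  have : (b - a) / (b - a + 2 * t) = 1 - 2 * t / (b - a + 2 * t) := by linarith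
  rw [this] at e1 e2
  nlinarith

lemma aux_gen (p : ℕ) (α y c : ℝ) (hy : 0 < y) :
    (2 * y) ^ α * (c / y) ^ (p + 1) = 2 ^ α * c ^ (p + 1) * y ^ (α - (p + 1)) := by
  have e : y ^ (α - ((p:ℝ) + 1)) = y ^ α / y ^ (p + 1) := by
    rw [Real.rpow_sub hy]
    congr 1
    exact_mod_cast Real.rpow_natCast y (p + 1)
  rw [e, Real.mul_rpow (by norm_num) hy.le, div_pow]
  ring

noncomputable def auxT (p : ℕ) (α θ : ℝ) (l : ℤ) : ℝ :=
  |θ + 2 * (l : ℝ) * Real.pi| ^ α * sincf (θ / 2 + (l : ℝ) * Real.pi) ^ (p + 1)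

lemma aux_pos (p : ℕ) (α θ : ℝ) (h0 : 0 ≤ θ) (n : ℕ) (hn : 1 ≤ n) :
    auxT p α θ (n : ℤ) = 2 ^ α * ((-1) ^ n * Real.sin (θ / 2)) ^ (p + 1)
      * (n * Real.pi + θ / 2) ^ (α - (p + 1)) := by
  have hn' : (1:ℝ) ≤ n := by exact_mod_cast hn
  have hy : 0 < n * Real.pi + θ / 2 := by
    have := Real.pi_pos
    positivity
  rw [← aux_gen p α _ _ hy, auxT, sincf, if_neg]
  · have e : Real.sin (θ / 2 + ((n:ℤ):ℝ) * Real.pi) = (-1) ^ n * Real.sin (θ / 2) := by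
      simpa using Real.sin_add_nat_mul_pi (θ / 2) n
    rw [e]
    have e2 : θ + 2 * ((n:ℤ):ℝ) * Real.pi = 2 * (n * Real.pi + θ / 2) := by push_cast; ring
    rw [e2, abs_of_pos (by positivity)]
    congr 3
    push_cast; ring
  · push_cast; linarith

lemma aux_neg (p : ℕ) (α θ : ℝ) (h1 : θ ≤ Real.pi) (n : ℕ) (hn : 1 ≤ n) :
    auxT p α θ (-(n : ℤ)) = 2 ^ α * (-((-1) ^ n * Real.sin (θ / 2))) ^ (p + 1)
      * (n * Real.pi - θ / 2) ^ (α - (p + 1)) := by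
  have hn' : (1:ℝ) ≤ n := by exact_mod_cast hn
  have hy : 0 < n * Real.pi - θ / 2 := by
    have := Real.pi_pos
    nlinarith
  rw [← aux_gen p α _ _ hy, auxT, sincf, if_neg]
  · have e : Real.sin (θ / 2 + ((-(n:ℤ):ℤ):ℝ) * Real.pi) = (-1) ^ n * Real.sin (θ / 2) := by
      have := Real.sin_sub_nat_mul_pi (θ / 2) n
      rw [← this]
      congr 1
      push_cast; ring
    rw [e]
    have e2 : θ + 2 * ((-(n:ℤ):ℤ):ℝ) * Real.pi = -(2 * (n * Real.pi - θ / 2)) := by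
      push_cast; ring
    rw [e2, abs_neg, abs_of_pos (by positivity)]
    congr 2
    rw [neg_div, ← div_neg]
    congr 1
    push_cast; ring
  · push_cast; linarith

lemma aux_abs (α S y z s : ℝ) (p : ℕ) (ε : ℝ) (hε : |ε| = 1) (hS : 0 ≤ S) (hz : 0 < z)
    (hzy : z ≤ y) (hs : s ≤ 0) :
    |2 ^ α * (ε * S) ^ (p + 1) * y ^ s| ≤ 2 ^ α * S ^ (p + 1) * z ^ s := by
  rw [abs_mul, abs_mul, abs_pow, abs_mul, hε, one_mul, abs_of_nonneg hS,
    abs_of_nonneg (by positivity : (0:ℝ) ≤ 2 ^ α),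
    abs_of_nonneg (Real.rpow_nonneg (hz.le.trans hzy) s)]
  exact mul_le_mul_of_nonneg_left (Real.rpow_le_rpow_of_nonpos hz hzy hs) (by positivity)

lemma aux_bound (p : ℕ) (α θ : ℝ) (hα : α < p) (h0 : 0 ≤ θ) (h1 : θ ≤ Real.pi) (l : ℤ)
    (hl : l ≠ 0) :
    |auxT p α θ l| ≤ 2 ^ α * (Real.pi / 2) ^ (α - (p + 1)) * |(l:ℝ)| ^ (α - (p + 1))
      * Real.sin (θ / 2) ^ (p + 1) := by
  have hpi := Real.pi_pos
  have hS : 0 ≤ Real.sin (θ / 2) := Real.sin_nonneg_of_nonneg_of_le_pi (by linarith) (by linarith)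
  obtain ⟨n, hn⟩ := Int.eq_nat_or_neg l
  have hn1 : 1 ≤ n := by omega
  have hn' : (1:ℝ) ≤ n := by exact_mod_cast hn1
  have hz : 0 < (Real.pi / 2) * n := by positivity
  have key : ∀ y : ℝ, (Real.pi / 2) * n ≤ y → ∀ ε : ℝ, |ε| = 1 →
      |2 ^ α * (ε * Real.sin (θ / 2)) ^ (p + 1) * y ^ (α - (p + 1))| ≤
      2 ^ α * (Real.pi / 2) ^ (α - (p + 1)) * (n:ℝ) ^ (α - (p + 1))
      * Real.sin (θ / 2) ^ (p + 1) := by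
    intro y hy ε hε
    have := aux_abs α (Real.sin (θ / 2)) y _ (α - (p + 1)) p ε hε hS hz hy (by linarith)
    rw [Real.mul_rpow (by positivity) (by positivity)] at this
    linarith
  have habs : |(l:ℝ)| = n := by
    rcases hn with rfl | rfl <;> simp
  rw [habs]
  rcases hn with rfl | rfl
  · rw [aux_pos p α θ h0 n hn1]
    exact key _ (by nlinarith) _ (by simp)
  · rw [aux_neg p α θ h1 n hn1, ← neg_mul]
    exact key _ (by nlinarith) _ (by simp)

lemma aux_pair (p : ℕ) (α θ : ℝ) (hα : α < p) (h0 : 0 ≤ θ) (h1 : θ ≤ Real.pi) (k : ℕ) :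
    0 ≤ (auxT p α θ ((2 * k + 1 : ℕ) : ℤ) + auxT p α θ (-((2 * k + 1 : ℕ) : ℤ)))
      + (auxT p α θ ((2 * k + 2 : ℕ) : ℤ) + auxT p α θ (-((2 * k + 2 : ℕ) : ℤ))) := by
  have hpi := Real.pi_pos
  have hS : 0 ≤ Real.sin (θ / 2) := Real.sin_nonneg_of_nonneg_of_le_pi (by linarith) (by linarith)
  rw [aux_pos p α θ h0 _ (by omega), aux_pos p α θ h0 _ (by omega),
    aux_neg p α θ h1 _ (by omega), aux_neg p α θ h1 _ (by omega)]
  have hk : (0:ℝ) ≤ k := Nat.cast_nonneg k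
  have ha : θ / 2 < ((2 * k + 1 : ℕ):ℝ) * Real.pi := by push_cast; nlinarith
  have hab : ((2 * k + 1 : ℕ):ℝ) * Real.pi < ((2 * k + 2 : ℕ):ℝ) * Real.pi := by
    push_cast; nlinarith
  have e1 : (-1:ℝ) ^ (2 * k + 1) = -1 := Odd.neg_one_pow ⟨k, rfl⟩
  have e2 : (-1:ℝ) ^ (2 * k + 2) = 1 := Even.neg_one_pow ⟨k + 1, by ring⟩
  have h4 := aux_four (α - (p + 1)) (by linarith) _ _ (θ / 2) (by linarith) ha hab
  rw [e1, e2]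
  generalize ((2 * k + 1 : ℕ):ℝ) * Real.pi = a at *
  generalize ((2 * k + 2 : ℕ):ℝ) * Real.pi = b at *
  simp only [neg_mul, one_mul, neg_neg]
  have hc : (0:ℝ) ≤ 2 ^ α * Real.sin (θ / 2) ^ (p + 1) := by positivity
  rcases Nat.even_or_odd (p + 1) with he | ho
  · rw [he.neg_pow]
    have := Real.rpow_nonneg (by linarith : 0 ≤ a + θ / 2) (α - (p + 1))
    have := Real.rpow_nonneg (by linarith : 0 ≤ a - θ / 2) (α - (p + 1))
    have := Real.rpow_nonneg (by linarith : 0 ≤ b + θ / 2) (α - (p + 1))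
    have := Real.rpow_nonneg (by linarith : 0 ≤ b - θ / 2) (α - (p + 1))
    positivity
  · rw [ho.neg_pow]
    nlinarith [mul_le_mul_of_nonneg_left h4 hc]

lemma aux_tsum (g : ℤ → ℝ) (hg : Summable g) (h00 : g 0 = 0)
    (hpair : ∀ k : ℕ, 0 ≤ (g ((2 * k + 1 : ℕ) : ℤ) + g (-((2 * k + 1 : ℕ) : ℤ)))
      + (g ((2 * k + 2 : ℕ) : ℤ) + g (-((2 * k + 2 : ℕ) : ℤ)))) : 0 ≤ ∑' l, g l := by
  have s1 : Summable (fun n : ℕ => g ((n:ℤ) + 1)) := by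
    refine hg.comp_injective (i := fun n : ℕ => (n:ℤ) + 1) (fun a b h => ?_)
    simp only at h
    omega
  have s2 : Summable (fun n : ℕ => g (-((n:ℤ) + 1))) := by
    refine hg.comp_injective (i := fun n : ℕ => -((n:ℤ) + 1)) (fun a b h => ?_)
    simp only at h
    omega
  rw [tsum_of_add_one_of_neg_add_one s1 s2, h00, add_zero, ← s1.tsum_add s2]
  have s3 := s1.add s2
  have s4 : Summable (fun k : ℕ => g (((2 * k : ℕ):ℤ) + 1) + g (-(((2 * k : ℕ):ℤ) + 1))) :=
    s3.comp_injective (i := fun k : ℕ => 2 * k) (fun a b h => by simp only at h; omega)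
  have s5 : Summable (fun k : ℕ => g (((2 * k + 1 : ℕ):ℤ) + 1) + g (-(((2 * k + 1 : ℕ):ℤ) + 1))) :=
    s3.comp_injective (i := fun k : ℕ => 2 * k + 1) (fun a b h => by simp only at h; omega)
  rw [← tsum_even_add_odd (f := fun n : ℕ => g ((n:ℤ) + 1) + g (-((n:ℤ) + 1))) s4 s5,
    ← s4.tsum_add s5]
  refine tsum_nonneg fun k => ?_
  have := hpair k
  have q1 : (((2 * k : ℕ) : ℤ) + 1) = ((2 * k + 1 : ℕ) : ℤ) := by push_cast; ring
  have q3 : (((2 * k + 1 : ℕ) : ℤ) + 1) = ((2 * k + 2 : ℕ) : ℤ) := by push_cast; ring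
  rw [q1, q3]
  exact this

theorem stmt7 (p : ℕ) (hp : 2 ≤ p) (α : ℝ) (h1 : 1 < α) (h2 : α < 2) (hpα : α < p) :
    ∃ C > (0 : ℝ), ∀ θ ∈ Set.Icc (0 : ℝ) Real.pi,
      θ ^ α * sincf (θ / 2) ^ (p + 1) ≤ fSymbol p α θ ∧
      fSymbol p α θ ≤ θ ^ α * sincf (θ / 2) ^ (p + 1) + C * Real.sin (θ / 2) ^ (p + 1) := by
  have hpi := Real.pi_pos
  let B : ℤ → ℝ := fun l => 2 ^ α * (Real.pi / 2) ^ (α - (p + 1)) * |(l:ℝ)| ^ (α - (p + 1))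
  have hB0 : ∀ l, 0 ≤ B l := fun l => by positivity
  have hB : Summable B := by
    have := (Real.summable_abs_int_rpow (b := p + 1 - α) (by linarith)).mul_left
      (2 ^ α * (Real.pi / 2) ^ (α - (p + 1)))
    simpa only [neg_sub] using this
  refine ⟨(∑' l, B l) + 1, add_pos_of_nonneg_of_pos (tsum_nonneg hB0) one_pos, ?_⟩
  rintro θ ⟨hθ0, hθ1⟩
  have hS : 0 ≤ Real.sin (θ / 2) :=
    Real.sin_nonneg_of_nonneg_of_le_pi (by linarith) (by linarith)
  set W := Real.sin (θ / 2) ^ (p + 1) with hW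
  have hW0 : 0 ≤ W := by positivity
  let T' : ℤ → ℝ := fun l => if l = 0 then 0 else auxT p α θ l
  have hT'b : ∀ l, ‖T' l‖ ≤ B l * W := by
    intro l
    by_cases hl : l = 0
    · simp only [T', if_pos hl, norm_zero]
      exact mul_nonneg (hB0 l) hW0
    · simp only [T', if_neg hl, Real.norm_eq_abs]
      exact aux_bound p α θ hpα hθ0 hθ1 l hl
  have hBW := hB.mul_right W
  have hT' : Summable T' := Summable.of_norm_bounded hBW hT'b
  have hT : Summable (auxT p α θ) := by
    refine (hT'.add (hasSum_ite_eq (0:ℤ) (auxT p α θ 0)).summable).congr ?_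
    intro l
    by_cases hl : l = 0 <;> simp [T', hl]
  have hf : fSymbol p α θ = auxT p α θ 0 + ∑' l, T' l := hT.tsum_eq_add_tsum_ite 0
  have hz : auxT p α θ 0 = θ ^ α * sincf (θ / 2) ^ (p + 1) := by
    simp [auxT, abs_of_nonneg hθ0]
  have hup : ∑' l, T' l ≤ (∑' l, B l) * W := by
    rw [← tsum_mul_right]
    exact hT'.tsum_le_tsum (fun l => (le_abs_self _).trans (hT'b l)) hBW
  have hlow : 0 ≤ ∑' l, T' l := by
    refine aux_tsum T' hT' (by simp [T']) fun k => ?_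
    have := aux_pair p α θ hpα hθ0 hθ1 k
    simp only [T']
    rw [if_neg (by omega), if_neg (by omega), if_neg (by omega), if_neg (by omega)]
    exact this
  rw [hf, hz]
  constructor
  · linarith
  · nlinarith
end

section
/- Let p ≥ 2 be an integer and let α ∈ (1,2) with p > α. Then f^{p,α}(π) / max_{θ∈[-π,π]} f^{p,α}(θ) ≤ f^{p,α}(π) / f^{p,α}(π/2) ≤ 2^{(2α+1-p)/2}. -/
open MeasureTheory

lemma hasSum_congr_aux {f g : ℕ → ℝ} {a : ℝ} (h : ∀ n, f n = g n) (H : HasSum g a) :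
    HasSum f a := by
  rwa [show f = g from funext h]

lemma term_eq (p : ℕ) (α θ x s c : ℝ) (l : ℤ) (hx : 0 < x)
    (hy : θ + 2 * (l : ℝ) * Real.pi = x ∨ θ + 2 * (l : ℝ) * Real.pi = -x)
    (hs : Real.sin (x / 2) = s * c) :
    |θ + 2 * (l : ℝ) * Real.pi| ^ α * sincf (θ / 2 + (l : ℝ) * Real.pi) ^ (p + 1)
      = (2 * c) ^ (p + 1) * (s ^ (p + 1) * x ^ (-((p : ℝ) + 1 - α))) := by
  have habs : |θ + 2 * (l : ℝ) * Real.pi| = x := by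
    rcases hy with h | h <;> rw [h]
    · exact abs_of_pos hx
    · rw [abs_neg]; exact abs_of_pos hx
  have hsinc : sincf (θ / 2 + (l : ℝ) * Real.pi) = 2 * c * s / x := by
    rcases hy with h | h
    · have : θ / 2 + (l : ℝ) * Real.pi = x / 2 := by linarith
      rw [this, sincf, if_neg (by positivity), hs]; field_simp
    · have : θ / 2 + (l : ℝ) * Real.pi = -(x / 2) := by linarith
      rw [this, sincf, if_neg (by simp [hx.ne']), Real.sin_neg, hs]; field_simp
  rw [habs, hsinc]
  have : x ^ (-((p : ℝ) + 1 - α)) = x ^ α / x ^ (p + 1) := by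
    rw [← Real.rpow_natCast x (p + 1), ← Real.rpow_sub hx]; congr 1; push_cast; ring
  rw [this, div_pow, mul_pow]; ring

lemma g_summable (b : ℝ) (hb : 1 < b) : Summable (fun n : ℕ => (n : ℝ) ^ (-b)) :=
  Real.summable_nat_rpow.2 (by linarith)

lemma g_summable' (b : ℝ) (hb : 1 < b) (a c : ℕ) (ha : 0 < a) :
    Summable (fun n : ℕ => (a * n + c : ℝ) ^ (-b)) := by
  have := (g_summable b hb).comp_injective (i := fun n : ℕ => a * n + c)
    (fun x y h => by
      have : a * x = a * y := by simpa using h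
      exact Nat.eq_of_mul_eq_mul_left ha this)
  refine this.congr ?_
  intro n
  simp

lemma sgn_summable (b : ℝ) (hb : 1 < b) (a c : ℕ) (ha : 0 < a) (s : ℝ) (hs : s = 1 ∨ s = -1) :
    Summable (fun n : ℕ => s ^ n * (a * n + c : ℝ) ^ (-b)) := by
  apply Summable.of_norm
  convert (g_summable' b hb a c ha) using 2 with n
  rw [norm_mul, norm_pow]
  have : ‖s‖ = 1 := by rcases hs with h | h <;> simp [h]
  rw [this, one_pow, one_mul, Real.norm_of_nonneg (by positivity)]

lemma hmono (b : ℝ) (hb : 1 < b) (x y : ℝ) (hx : 0 < x) (h : x < y) : y ^ (-b) < x ^ (-b) :=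
  Real.rpow_lt_rpow_of_neg hx h (by linarith)

lemma split (f : ℕ → ℝ) (hf : Summable f) : ∑' n, f n = ∑' n, (f (2 * n) + f (2 * n + 1)) := by
  have h0 : Summable fun n => f (2 * n) := hf.comp_injective (fun x y h => by simpa using h)
  have h1 : Summable fun n => f (2 * n + 1) := hf.comp_injective (fun x y h => by simpa using h)
  rw [h0.tsum_add h1, tsum_even_add_odd h0 h1]

lemma split_summable (f : ℕ → ℝ) (hf : Summable f) :
    Summable fun n => (f (2 * n) + f (2 * n + 1)) := by
  have h0 : Summable fun n => f (2 * n) := hf.comp_injective (fun x y h => by simpa using h)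
  have h1 : Summable fun n => f (2 * n + 1) := hf.comp_injective (fun x y h => by simpa using h)
  exact h0.add h1

lemma TU (b : ℝ) (hb : 1 < b) (s : ℝ) (hs : s = 1 ∨ s = -1) :
    0 < ∑' n : ℕ, s ^ n * (2 * n + 1 : ℝ) ^ (-b) ∧
    ∑' n : ℕ, s ^ n * (2 * n + 1 : ℝ) ^ (-b) ≤
      ∑' n : ℕ, (s ^ n * (4 * n + 1 : ℝ) ^ (-b) + s ^ n * (4 * n + 3 : ℝ) ^ (-b)) := by
  have sT : Summable fun n : ℕ => s ^ n * (2 * n + 1 : ℝ) ^ (-b) := by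
    simpa using sgn_summable b hb 2 1 (by norm_num) s hs
  have sU : Summable fun n : ℕ =>
      (s ^ n * (4 * n + 1 : ℝ) ^ (-b) + s ^ n * (4 * n + 3 : ℝ) ^ (-b)) := by
    simpa using (sgn_summable b hb 4 1 (by norm_num) s hs).add
      (sgn_summable b hb 4 3 (by norm_num) s hs)
  have hT := split _ sT
  have sT' := split_summable _ sT
  have hpos : 0 < ∑' n : ℕ, s ^ n * (2 * n + 1 : ℝ) ^ (-b) := by
    rw [hT]
    have key : ∀ n : ℕ, 0 < s ^ (2 * n) * (2 * (2 * n : ℕ) + 1 : ℝ) ^ (-b)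
        + s ^ (2 * n + 1) * (2 * (2 * n + 1 : ℕ) + 1 : ℝ) ^ (-b) := by
      intro n
      have h2 : s ^ 2 = 1 := by rcases hs with h | h <;> simp [h]
      rw [pow_succ, pow_mul, h2, one_pow]
      have := hmono b hb (2 * (2 * n : ℕ) + 1 : ℝ) (2 * (2 * n + 1 : ℕ) + 1 : ℝ)
        (by positivity) (by push_cast; linarith)
      have h3 : 0 < (2 * (2 * n + 1 : ℕ) + 1 : ℝ) ^ (-b) := by positivity
      rcases hs with h | h <;> rw [h] <;> linarith
    exact sT'.tsum_pos (fun n => (key n).le) 0 (key 0)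
  refine ⟨hpos, ?_⟩
  rcases hs with h | h
  · subst h
    rw [hT]
    apply le_of_eq
    congr 1
    ext n
    push_cast
    simp only [one_pow, one_mul]
    congr 2 <;> ring
  · rw [hT, split _ sT', split _ sU]
    refine (split_summable _ sT').tsum_le_tsum ?_ (split_summable _ sU)
    intro n
    subst h
    have e1 : (-1 : ℝ) ^ (2 * n) = 1 := by simp [pow_mul]
    have e2 : (-1 : ℝ) ^ (2 * (2 * n)) = 1 := by simp [pow_mul]
    have e3 : (-1 : ℝ) ^ (2 * (2 * n + 1)) = 1 := by simp [pow_mul]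
    simp only [pow_succ _ (2 * n), pow_succ _ (2 * (2 * n)), pow_succ _ (2 * (2 * n + 1)),
      e1, e2, e3]
    push_cast
    have := hmono b hb (8 * n + 3 : ℝ) (8 * n + 5 : ℝ) (by positivity) (by linarith)
    rw [show (2 * (2 * (2 * n)) + 1 : ℝ) = 8 * n + 1 by ring,
      show (2 * (2 * (2 * n) + 1) + 1 : ℝ) = 8 * n + 3 by ring,
      show (2 * (2 * (2 * n + 1)) + 1 : ℝ) = 8 * n + 5 by ring,
      show (2 * (2 * (2 * n + 1) + 1) + 1 : ℝ) = 8 * n + 7 by ring,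
      show (4 * (2 * n) + 1 : ℝ) = 8 * n + 1 by ring,
      show (4 * (2 * n) + 3 : ℝ) = 8 * n + 3 by ring,
      show (4 * (2 * n + 1) + 1 : ℝ) = 8 * n + 5 by ring,
      show (4 * (2 * n + 1) + 3 : ℝ) = 8 * n + 7 by ring]
    linarith

lemma sin_shift (n : ℕ) (y : ℝ) : Real.sin (n * Real.pi + y) = (-1) ^ n * Real.sin y := by
  rw [add_comm, Real.sin_add_nat_mul_pi]

lemma sgn_cases (p : ℕ) : ((-1 : ℝ) ^ (p + 1)) = 1 ∨ ((-1 : ℝ) ^ (p + 1)) = -1 :=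
  neg_one_pow_eq_or ℝ (p + 1)

lemma f_pi (p : ℕ) (α : ℝ) (hpα : α < p) :
    fSymbol p α Real.pi = 2 * (2 ^ (p + 1) * Real.pi ^ (-((p : ℝ) + 1 - α))) *
      ∑' n : ℕ, ((-1 : ℝ) ^ (p + 1)) ^ n * (2 * n + 1 : ℝ) ^ (-((p : ℝ) + 1 - α)) := by
  have hpi := Real.pi_pos
  have sT : Summable fun n : ℕ =>
      ((-1 : ℝ) ^ (p + 1)) ^ n * (2 * n + 1 : ℝ) ^ (-((p : ℝ) + 1 - α)) := by
    simpa using sgn_summable ((p : ℝ) + 1 - α) (by linarith) 2 1 (by norm_num) _ (sgn_cases p)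
  have H := sT.hasSum.mul_left (2 ^ (p + 1) * Real.pi ^ (-((p : ℝ) + 1 - α)))
  have hsin : ∀ n : ℕ, Real.sin ((2 * n + 1) * Real.pi / 2) = (-1) ^ n * 1 := by
    intro n
    rw [show (2 * n + 1) * Real.pi / 2 = n * Real.pi + Real.pi / 2 by ring, sin_shift]
    simp
  rw [fSymbol, (HasSum.of_nat_of_neg_add_one (f := fun l : ℤ =>
    |Real.pi + 2 * (l : ℝ) * Real.pi| ^ α * sincf (Real.pi / 2 + (l : ℝ) * Real.pi) ^ (p + 1))
    (m := 2 ^ (p + 1) * Real.pi ^ (-((p : ℝ) + 1 - α)) * ∑' n : ℕ,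
      ((-1 : ℝ) ^ (p + 1)) ^ n * (2 * n + 1 : ℝ) ^ (-((p : ℝ) + 1 - α))) (m' := 2 ^ (p + 1) * Real.pi ^ (-((p : ℝ) + 1 - α)) * ∑' n : ℕ,
      ((-1 : ℝ) ^ (p + 1)) ^ n * (2 * n + 1 : ℝ) ^ (-((p : ℝ) + 1 - α))) ?_ ?_).tsum_eq]
  rotate_left
  · refine hasSum_congr_aux ?_ H
    intro n
    beta_reduce
    rw [term_eq p α _ ((2 * n + 1) * Real.pi) ((-1) ^ n) 1 (n : ℤ) (by positivity)
      (Or.inl (by push_cast; ring)) (hsin n), Real.mul_rpow (by positivity) hpi.le,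
      pow_right_comm, mul_one]
    ring
  · refine hasSum_congr_aux ?_ H
    intro n
    beta_reduce
    rw [term_eq p α _ ((2 * n + 1) * Real.pi) ((-1) ^ n) 1 (-((n : ℤ) + 1)) (by positivity)
      (Or.inr (by push_cast; ring)) (hsin n), Real.mul_rpow (by positivity) hpi.le,
      pow_right_comm, mul_one]
    ring
  ring

lemma f_pi2 (p : ℕ) (α : ℝ) (hpα : α < p) :
    fSymbol p α (Real.pi / 2) = ((√2) ^ (p + 1) * (Real.pi / 2) ^ (-((p : ℝ) + 1 - α))) *
      ∑' n : ℕ, (((-1 : ℝ) ^ (p + 1)) ^ n * (4 * n + 1 : ℝ) ^ (-((p : ℝ) + 1 - α))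
        + ((-1 : ℝ) ^ (p + 1)) ^ n * (4 * n + 3 : ℝ) ^ (-((p : ℝ) + 1 - α))) := by
  have hpi := Real.pi_pos
  have s1 : Summable fun n : ℕ =>
      ((-1 : ℝ) ^ (p + 1)) ^ n * (4 * n + 1 : ℝ) ^ (-((p : ℝ) + 1 - α)) := by
    simpa using sgn_summable ((p : ℝ) + 1 - α) (by linarith) 4 1 (by norm_num) _ (sgn_cases p)
  have s3 : Summable fun n : ℕ =>
      ((-1 : ℝ) ^ (p + 1)) ^ n * (4 * n + 3 : ℝ) ^ (-((p : ℝ) + 1 - α)) := by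
    simpa using sgn_summable ((p : ℝ) + 1 - α) (by linarith) 4 3 (by norm_num) _ (sgn_cases p)
  have H1 := s1.hasSum.mul_left ((√2) ^ (p + 1) * (Real.pi / 2) ^ (-((p : ℝ) + 1 - α)))
  have H3 := s3.hasSum.mul_left ((√2) ^ (p + 1) * (Real.pi / 2) ^ (-((p : ℝ) + 1 - α)))
  have hsin1 : ∀ n : ℕ, Real.sin ((4 * n + 1) * (Real.pi / 2) / 2) = (-1) ^ n * (√2 / 2) := by
    intro n
    rw [show (4 * n + 1) * (Real.pi / 2) / 2 = n * Real.pi + Real.pi / 4 by ring, sin_shift]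
    simp
  have hsin3 : ∀ n : ℕ, Real.sin ((4 * n + 3) * (Real.pi / 2) / 2) = (-1) ^ n * (√2 / 2) := by
    intro n
    rw [show (4 * n + 3) * (Real.pi / 2) / 2 = n * Real.pi + (Real.pi - Real.pi / 4) by ring,
      sin_shift, Real.sin_pi_sub]
    simp
  rw [s1.tsum_add s3, fSymbol, (HasSum.of_nat_of_neg_add_one (f := fun l : ℤ =>
    |Real.pi / 2 + 2 * (l : ℝ) * Real.pi| ^ α *
      sincf (Real.pi / 2 / 2 + (l : ℝ) * Real.pi) ^ (p + 1))
    (m := (√2) ^ (p + 1) * (Real.pi / 2) ^ (-((p : ℝ) + 1 - α)) * ∑' n : ℕ,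
      ((-1 : ℝ) ^ (p + 1)) ^ n * (4 * n + 1 : ℝ) ^ (-((p : ℝ) + 1 - α))) (m' := (√2) ^ (p + 1) * (Real.pi / 2) ^ (-((p : ℝ) + 1 - α)) * ∑' n : ℕ,
      ((-1 : ℝ) ^ (p + 1)) ^ n * (4 * n + 3 : ℝ) ^ (-((p : ℝ) + 1 - α))) ?_ ?_).tsum_eq]
  rotate_left
  · refine hasSum_congr_aux ?_ H1
    intro n
    beta_reduce
    rw [term_eq p α _ ((4 * n + 1) * (Real.pi / 2)) ((-1) ^ n) (√2 / 2) (n : ℤ) (by positivity)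
      (Or.inl (by push_cast; ring)) (hsin1 n), Real.mul_rpow (by positivity) (by positivity),
      pow_right_comm, mul_div_cancel₀ _ (two_ne_zero)]
    ring
  · refine hasSum_congr_aux ?_ H3
    intro n
    beta_reduce
    rw [term_eq p α _ ((4 * n + 3) * (Real.pi / 2)) ((-1) ^ n) (√2 / 2) (-((n : ℤ) + 1)) (by positivity)
      (Or.inr (by push_cast; ring)) (hsin3 n), Real.mul_rpow (by positivity) (by positivity),
      pow_right_comm, mul_div_cancel₀ _ (two_ne_zero)]
    ring
  ring

lemma const_eq (p : ℕ) (α : ℝ) :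
    2 * (2 ^ (p + 1) * Real.pi ^ (-((p : ℝ) + 1 - α))) =
      (2 : ℝ) ^ ((2 * α + 1 - (p : ℝ)) / 2) *
        ((√2) ^ (p + 1) * (Real.pi / 2) ^ (-((p : ℝ) + 1 - α))) := by
  have h : (√2) ^ (p + 1) = (2 : ℝ) ^ (((p : ℝ) + 1) / 2) := by
    rw [Real.sqrt_eq_rpow, ← Real.rpow_natCast, ← Real.rpow_mul (by norm_num)]
    congr 1; push_cast; ring
  rw [h, Real.div_rpow Real.pi_pos.le (by norm_num), div_eq_mul_inv (Real.pi ^ _),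
    ← Real.rpow_neg (by norm_num), ← Real.rpow_natCast 2 (p + 1)]
  have : (2 : ℝ) * (2 : ℝ) ^ ((p + 1 : ℕ) : ℝ) = (2 : ℝ) ^ ((2 * α + 1 - (p : ℝ)) / 2) *
      (2 : ℝ) ^ (((p : ℝ) + 1) / 2) * (2 : ℝ) ^ (- -((p : ℝ) + 1 - α)) := by
    rw [← Real.rpow_add (by norm_num), ← Real.rpow_add (by norm_num)]
    nth_rewrite 1 [← Real.rpow_one 2]
    rw [← Real.rpow_add (by norm_num)]
    congr 1; push_cast; ring
  linear_combination Real.pi ^ (-((p : ℝ) + 1 - α)) * this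

theorem stmt8 (p : ℕ) (hp : 2 ≤ p) (α : ℝ) (h1 : 1 < α) (h2 : α < 2) (hpα : α < p) :
    fSymbol p α Real.pi / sSup (fSymbol p α '' Set.Icc (-Real.pi) Real.pi)
        ≤ fSymbol p α Real.pi / fSymbol p α (Real.pi / 2) ∧
      fSymbol p α Real.pi / fSymbol p α (Real.pi / 2)
        ≤ (2 : ℝ) ^ ((2 * α + 1 - (p : ℝ)) / 2) := by
  have hpi := Real.pi_pos
  obtain ⟨hT, hU⟩ := TU ((p : ℝ) + 1 - α) (by linarith) _ (sgn_cases p)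
  have e1 := f_pi p α hpα
  have e2 := f_pi2 p α hpα
  rw [const_eq] at e1
  have hB : 0 < ((√2) ^ (p + 1) * (Real.pi / 2) ^ (-((p : ℝ) + 1 - α))) := by positivity
  have hC : 0 < (2 : ℝ) ^ ((2 * α + 1 - (p : ℝ)) / 2) := by positivity
  have p1 : 0 < fSymbol p α Real.pi := by rw [e1]; exact mul_pos (mul_pos hC hB) hT
  have p2 : 0 < fSymbol p α (Real.pi / 2) := by rw [e2]; exact mul_pos hB (hT.trans_le hU)
  constructor
  · by_cases hb : BddAbove (fSymbol p α '' Set.Icc (-Real.pi) Real.pi)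
    · exact div_le_div_of_nonneg_left p1.le p2
        (le_csSup hb ⟨Real.pi / 2, ⟨by linarith, by linarith⟩, rfl⟩)
    · rw [Real.sSup_of_not_bddAbove hb, div_zero]
      positivity
  · rw [div_le_iff₀ p2, e1, e2, mul_assoc]
    gcongr
end

section
/- Let p ≥ 2 be an integer, α ∈ (1,2), and n ≥ p+1. Then for all interior indices i, j ∈ {p+1, …, n}, the fractional derivatives of the interior B-splines at the Greville abscissae are evaluations of fractional derivatives of the cardinal B-spline: RL_0 D_x^α N_j^p(η_i) = n^α · D₋^α φ_p((p+1)/2 + i - j) and RL_x D_1^α N_j^p(η_i) = n^α · D₊^α φ_p((p+1)/2 + i - j). -/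
open MeasureTheory

/-- Open uniform knot sequence on [0,1]. -/
noncomputable def knot (p n : ℕ) (i : ℕ) : ℝ :=
  if i ≤ p + 1 then 0 else if n + p + 1 ≤ i then 1 else ((i : ℝ) - ((p : ℝ) + 1)) / n

/-- B-splines of degree `k` (Cox–de Boor recurrence) on the above knots. -/
noncomputable def bspline (p n : ℕ) : ℕ → ℕ → ℝ → ℝ
  | 0, i, x => if knot p n i ≤ x ∧ x < knot p n (i + 1) then 1 else 0
  | (k + 1), i, x =>
      (if knot p n (i + k + 1) = knot p n i then 0
        else (x - knot p n i) / (knot p n (i + k + 1) - knot p n i) * bspline p n k i x)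
      + (if knot p n (i + k + 2) = knot p n (i + 1) then 0
        else (knot p n (i + k + 2) - x) / (knot p n (i + k + 2) - knot p n (i + 1))
              * bspline p n k (i + 1) x)

/-- Greville abscissae. -/
noncomputable def greville (p n : ℕ) (i : ℕ) : ℝ :=
  (∑ j ∈ Finset.range p, knot p n (i + 1 + j)) / p

/-- Left Riemann–Liouville fractional derivative on `[0,1]`, `α ∈ (1,2)`. -/
noncomputable def RLD0x (α : ℝ) (u : ℝ → ℝ) (x : ℝ) : ℝ :=
  (1 / Real.Gamma (2 - α)) *
    deriv (deriv (fun z => ∫ y in (0:ℝ)..z, (z - y) ^ (1 - α) * u y)) x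

/-- Right Riemann–Liouville fractional derivative on `[0,1]`, `α ∈ (1,2)`. -/
noncomputable def RLDx1 (α : ℝ) (u : ℝ → ℝ) (x : ℝ) : ℝ :=
  (1 / Real.Gamma (2 - α)) *
    deriv (deriv (fun z => ∫ y in z..(1:ℝ), (y - z) ^ (1 - α) * u y)) x

lemma card_zero_neg (p : ℕ) : ∀ t : ℝ, t < 0 → cardinalBSpline p t = 0 := by
  induction p with
  | zero => intro t ht; simp [cardinalBSpline, not_le.mpr ht]
  | succ p ih => intro t ht; simp [cardinalBSpline, ih t ht, ih (t-1) (by linarith)]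

lemma card_zero_large (p : ℕ) : ∀ t : ℝ, (p:ℝ) + 1 ≤ t → cardinalBSpline p t = 0 := by
  induction p with
  | zero => intro t ht; simp [cardinalBSpline]; intro _; simpa using ht
  | succ p ih =>
    intro t ht
    push_cast at ht
    simp [cardinalBSpline, ih t (by linarith), ih (t-1) (by linarith)]

lemma knot_mid (p n i : ℕ) (hn : 0 < n) (h1 : p + 1 ≤ i) (h2 : i ≤ n + p + 1) :
    knot p n i = ((i : ℝ) - ((p : ℝ) + 1)) / n := by
  have hn' : (n:ℝ) ≠ 0 := by positivity
  unfold knot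
  split_ifs with h h'
  · have : i = p + 1 := by omega
    subst this; simp
  · have : i = n + p + 1 := by omega
    subst this; push_cast; field_simp; ring
  · rfl

lemma bspline_eq_s12 (p n : ℕ) (hn : 0 < n) (k : ℕ) : ∀ j : ℕ, p + 1 ≤ j → j + k ≤ n + p → ∀ x : ℝ,
    bspline p n k j x = cardinalBSpline k ((n:ℝ) * x - ((j:ℝ) - (p:ℝ) - 1)) := by
  have hn' : (0:ℝ) < n := by positivity
  induction k with
  | zero =>
    intro j h1 h2 x
    simp only [bspline, cardinalBSpline]
    rw [knot_mid p n j hn h1 (by omega), knot_mid p n (j+1) hn (by omega) (by omega)]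
    congr 1
    rw [div_le_iff₀ hn', lt_div_iff₀ hn']
    push_cast
    apply propext
    constructor <;> rintro ⟨a, b⟩ <;> constructor <;> linarith
  | succ k ih =>
    intro j h1 h2 x
    simp only [bspline, cardinalBSpline]
    rw [knot_mid p n j hn h1 (by omega), knot_mid p n (j+1) hn (by omega) (by omega),
      knot_mid p n (j+k+1) hn (by omega) (by omega), knot_mid p n (j+k+2) hn (by omega) (by omega),
      ih j h1 (by omega), ih (j+1) (by omega) (by omega)]
    have hk : (0:ℝ) < (k:ℝ) + 1 := by positivity
    have e1 : (((j + k + 1 : ℕ):ℝ) - ((p:ℝ)+1)) / n - ((j:ℝ) - ((p:ℝ)+1)) / n = ((k:ℝ)+1)/n := by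
      push_cast; ring
    have e2 : (((j + k + 2 : ℕ):ℝ) - ((p:ℝ)+1)) / n - (((j+1:ℕ):ℝ) - ((p:ℝ)+1)) / n
        = ((k:ℝ)+1)/n := by
      push_cast; ring
    have hpos : (0:ℝ) < ((k:ℝ)+1)/n := by positivity
    rw [if_neg (by intro h; rw [h, sub_self] at e1; linarith),
      if_neg (by intro h; rw [h, sub_self] at e2; linarith), e1, e2]
    have e3 : (n:ℝ) * x - (((j+1:ℕ):ℝ) - (p:ℝ) - 1) = (n:ℝ) * x - ((j:ℝ) - (p:ℝ) - 1) - 1 := by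
      push_cast; ring
    rw [e3]
    congr 1
    · congr 1; field_simp; ring
    · congr 1; push_cast; field_simp; ring

lemma greville_eq (p n i : ℕ) (hp : 0 < p) (hn : 0 < n) (h1 : p + 1 ≤ i) (h2 : i ≤ n) :
    greville p n i = ((i:ℝ) - ((p:ℝ)+1)/2) / n := by
  have hn' : (n:ℝ) ≠ 0 := by positivity
  have hp' : (p:ℝ) ≠ 0 := by positivity
  have hs : ∀ m : ℕ, ∑ j ∈ Finset.range m, (((i:ℝ) - p + j) / n)
      = (m * ((i:ℝ) - p) + m * ((m:ℝ) - 1)/2) / n := by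
    intro m
    induction m with
    | zero => simp
    | succ m ih => rw [Finset.sum_range_succ, ih]; push_cast; ring
  unfold greville
  rw [Finset.sum_congr rfl (g := fun j : ℕ => (((i:ℝ) - p + j) / n)), hs]
  · field_simp; ring
  · intro j hj
    have := Finset.mem_range.mp hj
    rw [knot_mid p n _ hn (by omega) (by omega)]
    push_cast; ring

lemma scale_int (φ : ℝ → ℝ → ℝ) (n c : ℝ) (hn : 0 < n) (w : ℝ) :
    ∫ y, φ w (n * y - c) = n⁻¹ * ∫ t, φ w t := by
  have := Measure.integral_comp_mul_left (fun t => φ w (t - c)) n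
  rw [this, integral_sub_right_eq_self, abs_of_pos (by positivity), smul_eq_mul]

lemma left_scale (u : ℝ → ℝ) (n c a : ℝ) (hn : 0 < n) (z : ℝ) :
    ∫ y in Set.Iic z, (z - y) ^ (1 - a) * u (n * y - c)
      = n ^ (a - 2) * ∫ t in Set.Iic (n * z - c), (n * z - c - t) ^ (1 - a) * u t := by
  rw [← integral_indicator measurableSet_Iic, ← integral_indicator measurableSet_Iic]
  have := scale_int (fun w t => (Set.Iic w).indicator (fun t => (w - t) ^ (1 - a) * u t) t)
    n c hn (n * z - c)
  have e : n ^ (a - 2) = n ^ (a - 1) * n⁻¹ := by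
    rw [← Real.rpow_neg_one, ← Real.rpow_add hn]; congr 1; ring
  rw [e, mul_assoc, ← this, ← integral_const_mul]
  congr 1
  funext y
  by_cases hy : y ≤ z
  · have hy' : n * y - c ≤ n * z - c := by nlinarith
    rw [Set.indicator_of_mem (by exact hy), Set.indicator_of_mem (by exact hy')]
    have : n * z - c - (n * y - c) = n * (z - y) := by ring
    rw [this, Real.mul_rpow hn.le (by linarith), ← mul_assoc, ← mul_assoc, ← Real.rpow_add hn]
    simp
  · have hy' : ¬ (n * y - c ≤ n * z - c) := by
      push Not at hy ⊢; nlinarith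
    rw [Set.indicator_of_notMem (by exact hy), Set.indicator_of_notMem (by exact hy')]
    simp

lemma right_scale (u : ℝ → ℝ) (n c a : ℝ) (hn : 0 < n) (z : ℝ) :
    ∫ y in Set.Ici z, (y - z) ^ (1 - a) * u (n * y - c)
      = n ^ (a - 2) * ∫ t in Set.Ici (n * z - c), (t - (n * z - c)) ^ (1 - a) * u t := by
  rw [← integral_indicator measurableSet_Ici, ← integral_indicator measurableSet_Ici]
  have := scale_int (fun w t => (Set.Ici w).indicator (fun t => (t - w) ^ (1 - a) * u t) t)
    n c hn (n * z - c)
  have e : n ^ (a - 2) = n ^ (a - 1) * n⁻¹ := by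
    rw [← Real.rpow_neg_one, ← Real.rpow_add hn]; congr 1; ring
  rw [e, mul_assoc, ← this, ← integral_const_mul]
  congr 1
  funext y
  by_cases hy : z ≤ y
  · have hy' : n * z - c ≤ n * y - c := by nlinarith
    rw [Set.indicator_of_mem (by exact hy), Set.indicator_of_mem (by exact hy')]
    have : n * y - c - (n * z - c) = n * (y - z) := by ring
    rw [this, Real.mul_rpow hn.le (by linarith), ← mul_assoc, ← mul_assoc, ← Real.rpow_add hn]
    simp
  · have hy' : ¬ (n * z - c ≤ n * y - c) := by
      push Not at hy ⊢; nlinarith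
    rw [Set.indicator_of_notMem (by exact hy), Set.indicator_of_notMem (by exact hy')]
    simp

lemma deriv_aff (F : ℝ → ℝ) (n c : ℝ) :
    deriv (fun z => F (n * z - c)) = fun z => n * deriv F (n * z - c) := by
  funext z
  have := deriv_comp_mul_left n (fun t => F (t - c)) z
  rw [this, deriv_comp_sub_const, smul_eq_mul]

lemma deriv2_aff (F : ℝ → ℝ) (n c a : ℝ) (hn : 0 < n) (z : ℝ) :
    deriv (deriv (fun z => n ^ (a - 2) * F (n * z - c))) z
      = n ^ a * deriv (deriv F) (n * z - c) := by
  have h : deriv (fun z => n ^ (a - 2) * F (n * z - c))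
      = fun z => (n ^ (a - 2) * n) * deriv F (n * z - c) := by
    funext z
    rw [deriv_const_mul_field, deriv_aff]; ring
  rw [h, deriv_const_mul_field, deriv_aff]
  have : n ^ a = n ^ (a - 2) * n * n := by
    rw [mul_assoc, ← sq, ← Real.rpow_natCast, ← Real.rpow_add hn]; congr 1; push_cast; ring
  rw [this]; ring

theorem stmt12 (p n : ℕ) (hp : 2 ≤ p) (α : ℝ) (h1 : 1 < α) (h2 : α < 2)
    (hn : p + 1 ≤ n) (i j : ℕ) (hi1 : p + 1 ≤ i) (hi2 : i ≤ n) (hj1 : p + 1 ≤ j) (hj2 : j ≤ n) :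
    RLD0x α (bspline p n p j) (greville p n i)
        = (n : ℝ) ^ α
          * fracDerivLeft α (cardinalBSpline p) (((p : ℝ) + 1) / 2 + (i : ℝ) - (j : ℝ)) ∧
      RLDx1 α (bspline p n p j) (greville p n i)
        = (n : ℝ) ^ α
          * fracDerivRight α (cardinalBSpline p) (((p : ℝ) + 1) / 2 + (i : ℝ) - (j : ℝ)) := by
  have hn0 : 0 < n := by omega
  have hnr : (0:ℝ) < n := by exact_mod_cast hn0
  have hfl : ⌊α⌋₊ = 1 := by
    rw [Nat.floor_eq_iff (by linarith)]; constructor <;> push_cast <;> linarith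
  have hu : bspline p n p j
      = fun x => cardinalBSpline p ((n:ℝ) * x - ((j:ℝ) - (p:ℝ) - 1)) :=
    funext (bspline_eq_s12 p n hn0 p j hj1 (by omega))
  have hg := greville_eq p n i (by omega) hn0 hi1 hi2
  have hi1' : (p:ℝ) + 1 ≤ i := by exact_mod_cast hi1
  have hi2' : (i:ℝ) ≤ n := by exact_mod_cast hi2
  have hj1' : (p:ℝ) + 1 ≤ j := by exact_mod_cast hj1
  have hj2' : (j:ℝ) ≤ n := by exact_mod_cast hj2
  have hp0 : (0:ℝ) ≤ p := by positivity
  have hg0 : 0 < greville p n i := by rw [hg]; apply div_pos _ hnr; linarith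
  have hg1 : greville p n i < 1 := by rw [hg, div_lt_one hnr]; linarith
  have hpt : ((p : ℝ) + 1) / 2 + (i : ℝ) - (j : ℝ)
      = (n:ℝ) * greville p n i - ((j:ℝ) - (p:ℝ) - 1) := by
    rw [hg]; field_simp; ring
  have hex : ((1:ℕ):ℝ) + 1 - α - 1 = 1 - α := by push_cast; ring
  have hex2 : ((1:ℕ):ℝ) + 1 - α = 2 - α := by push_cast; ring
  unfold RLD0x RLDx1 fracDerivLeft fracDerivRight
  rw [hfl, hex, hex2, hpt, hu, iteratedDeriv_succ, iteratedDeriv_one, iteratedDeriv_succ,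
    iteratedDeriv_one]
  constructor
  · have hev : (fun z => ∫ y in (0:ℝ)..z, (z - y) ^ (1 - α)
          * cardinalBSpline p ((n:ℝ) * y - ((j:ℝ) - (p:ℝ) - 1)))
        =ᶠ[nhds (greville p n i)] (fun z => (n:ℝ) ^ (α - 2) *
          (fun w => ∫ t in Set.Iic w, (w - t) ^ (1 - α) * cardinalBSpline p t)
            ((n:ℝ) * z - ((j:ℝ) - (p:ℝ) - 1))) := by
      filter_upwards [lt_mem_nhds hg0] with z hz
      rw [← left_scale _ _ _ _ hnr, intervalIntegral.integral_of_le hz.le,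
        ← integral_Icc_eq_integral_Ioc]
      symm
      apply setIntegral_eq_of_subset_of_forall_sdiff_eq_zero measurableSet_Iic
        Set.Icc_subset_Iic_self
      rintro y ⟨hy1, hy2⟩
      have hy1' : y ≤ z := hy1
      have : y < 0 := by
        by_contra h; exact hy2 ⟨not_lt.mp h, hy1'⟩
      rw [card_zero_neg p _ (by nlinarith), mul_zero]
    rw [hev.deriv.deriv_eq.trans (deriv2_aff
      (fun w => ∫ t in Set.Iic w, (w - t) ^ (1 - α) * cardinalBSpline p t)
      (n:ℝ) ((j:ℝ) - (p:ℝ) - 1) α hnr (greville p n i))]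
    ring
  · have hev : (fun z => ∫ y in z..(1:ℝ), (y - z) ^ (1 - α)
          * cardinalBSpline p ((n:ℝ) * y - ((j:ℝ) - (p:ℝ) - 1)))
        =ᶠ[nhds (greville p n i)] (fun z => (n:ℝ) ^ (α - 2) *
          (fun w => ∫ t in Set.Ici w, (t - w) ^ (1 - α) * cardinalBSpline p t)
            ((n:ℝ) * z - ((j:ℝ) - (p:ℝ) - 1))) := by
      filter_upwards [gt_mem_nhds hg1] with z hz
      rw [← right_scale _ _ _ _ hnr, intervalIntegral.integral_of_le hz.le,
        ← integral_Icc_eq_integral_Ioc]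
      symm
      apply setIntegral_eq_of_subset_of_forall_sdiff_eq_zero measurableSet_Ici
        Set.Icc_subset_Ici_self
      rintro y ⟨hy1, hy2⟩
      have hy1' : z ≤ y := hy1
      have : 1 < y := by
        by_contra h; exact hy2 ⟨hy1', not_lt.mp h⟩
      rw [card_zero_large p _ (by nlinarith), mul_zero]
    rw [hev.deriv.deriv_eq.trans (deriv2_aff
      (fun w => ∫ t in Set.Ici w, (t - w) ^ (1 - α) * cardinalBSpline p t)
      (n:ℝ) ((j:ℝ) - (p:ℝ) - 1) α hnr (greville p n i))]
    ring
end
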